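/- General forbidden intersection theorem. For all D,M,k,C ∈ ℕ there is θ₁ > 0 such that for all ε,κ,γ ∈ (0,θ₁) there is θ₂ > 0 such that for all ζ ∈ (0,θ₂) there exist δ₀ > 0 and n₀ such that for all n ≥ n₀ and δ ∈ (0,δ₀] the following holds. Let S and the finite sets (J_s : s∈S) each have size at most C, and let R = (R_1,…,R_D) with all R_d > 0 and max_d R_d < n^C. Suppose: (1) μ_q is a κ-bounded product measure on (Π_{s∈S} J_s)ⁿ with marginals (μ_{p_s} : s∈S); (2) 𝒱 = (v^i_{(j_s)_{s∈S}}) is an R-bounded (n, Π_{s∈S} J_s)-array in ℤ^D; (3) 𝒰 = {u_1,…,u_M} ⊆ ℤ^D is R-bounded and (k, kζn, R)-generating; (4) 𝒱 has γ-robust transfers for 𝒰; (5) w ∈ ℤ^D with ‖w − 𝒱(μ_q)‖_R < ζn. Then for any sets 𝒜_s ⊆ J_sⁿ (s∈S) with Π_{s∈S} μ_{p_s}(𝒜_s) > (1−δ)ⁿ, we have μ_q((Π_{s∈S} 𝒜_s)^𝒱_w) > (1−ε)ⁿ. -/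

import Mathlib

open Finset

noncomputable section

/-- The `R`-scaled sup-norm `max_d |v d| / R d`. -/
noncomputable def rnorm {D : ℕ} (R : Fin D → ℝ) (v : Fin D → ℝ) : ℝ :=
  ⨆ d, |v d| / R d

/-- Evaluation of an `(n,J)`-array at `a ∈ Jⁿ`. -/
def arrEval {n D : ℕ} {J : Type*} (V : Fin n → J → Fin D → ℤ)
    (a : Fin n → J) (d : Fin D) : ℤ :=
  ∑ i, V i (a i) d

/-- Product measure on `Jⁿ` from weights `p`. -/
def prodMeas {n : ℕ} {J : Type*} (p : Fin n → J → ℝ) (a : Fin n → J) : ℝ :=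
  ∏ i, p i (a i)

/-- Measure of a set under a (finitely supported) measure `μ`. -/
noncomputable def smeas {α : Type*} [Fintype α] (μ : α → ℝ) (A : Set α) : ℝ :=
  ∑ x, A.indicator μ x

/-- Expectation `𝒱(μ) d = E_{a∼μ} 𝒱(a) d`. -/
noncomputable def arrExp {n D : ℕ} {J : Type*} [Fintype J]
    (V : Fin n → J → Fin D → ℤ) (μ : (Fin n → J) → ℝ) (d : Fin D) : ℝ :=
  ∑ a : Fin n → J, μ a * (arrEval V a d : ℝ)

/-- `𝒰 = (u_m)` is `(k,B,R)`-generating in `ℤ^D`. -/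
def GeneratingSet {D M : ℕ} (U : Fin M → Fin D → ℤ) (k : ℕ) (B : ℝ)
    (R : Fin D → ℝ) : Prop :=
  ∀ u : Fin D → ℤ, ∃ c : Fin M → ℤ,
    (∀ m, |(c m : ℝ)| ≤ (k : ℝ) * rnorm R (fun d => (u d : ℝ)) + B) ∧
    ∀ d, u d = ∑ m, c m * U m d

/-- Combination of two strings over the product alphabet `∀ s, J s` along a set `S'`
of coordinates: take `a` on `S'` and `b` off `S'`. -/
def combine {S : Type*} [DecidableEq S] {J : S → Type*} (S' : Finset S)
    (a b : ∀ s, J s) : ∀ s, J s :=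
  fun s => if s ∈ S' then a s else b s

/-- `u` is an `i`-transfer in the array `V`, viewed as an `(n, J×L)`-array via the
splitting of the product alphabet given by `S'`. -/
def IsTransfer {n D : ℕ} {S : Type*} [DecidableEq S] {J : S → Type*} (S' : Finset S)
    (V : Fin n → (∀ s, J s) → Fin D → ℤ) (i : Fin n) (u : Fin D → ℤ) : Prop :=
  ∃ a a' b b' : ∀ s, J s,
    (∀ d, V i (combine S' a b) d - V i (combine S' a' b) d = u d) ∧
    (∀ d, V i (combine S' a' b') d = V i (combine S' a b') d)

/-- `V` has `γ`-robust transfers for `𝒰 = (u_m)`. -/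
def HasRobustTransfers {n D M : ℕ} {S : Type*} [DecidableEq S] {J : S → Type*}
    (γ : ℝ) (U : Fin M → Fin D → ℤ) (V : Fin n → (∀ s, J s) → Fin D → ℤ) : Prop :=
  ∃ S' : Finset S, ∃ P : Fin M → Finset (Fin n),
    (∀ m m', m ≠ m' → Disjoint (P m) (P m')) ∧
    (∀ m, γ * n ≤ ((P m).card : ℝ)) ∧
    ∀ m, ∀ i ∈ P m, IsTransfer S' V i (U m)

section Measure

variable {n : ℕ} {K : Type*}

theorem prodMeas_nonneg {q : Fin n → K → ℝ} (hq : ∀ i x, 0 ≤ q i x) (a : Fin n → K) :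
    0 ≤ prodMeas q a :=
  Finset.prod_nonneg fun i _ => hq i (a i)

variable [Fintype K]

theorem sum_prodMeas_mul_prod (q f : Fin n → K → ℝ) :
    ∑ a : Fin n → K, prodMeas q a * ∏ i, f i (a i) = ∏ i, ∑ x, q i x * f i x := by
  rw [Finset.prod_univ_sum, Fintype.piFinset_univ]
  simp [prodMeas, Finset.prod_mul_distrib]

theorem sum_prodMeas {q : Fin n → K → ℝ} (hq : ∀ i, ∑ x, q i x = 1) :
    ∑ a : Fin n → K, prodMeas q a = 1 := by
  simpa [hq] using sum_prodMeas_mul_prod q (fun _ _ => 1)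

/-- Resampling one coordinate of a product measure does not change expectations. -/
theorem sum_prodMeas_update {q : Fin n → K → ℝ} (i : Fin n) (hq : ∑ x, q i x = 1)
    (f : (Fin n → K) → ℝ) :
    ∑ a, prodMeas q a * f a
      = ∑ x, q i x * ∑ a, prodMeas q a * f (Function.update a i x) := by
  have key : ∀ (x : K) (a : Fin n → K),
      q i x * prodMeas q a = q i (a i) * prodMeas q (Function.update a i x) := by
    intro x a
    have h1 : prodMeas q a = q i (a i) * ∏ j ∈ univ.erase i, q j (a j) :=
      (Finset.mul_prod_erase univ (fun j => q j (a j)) (mem_univ i)).symm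
    have h2 : prodMeas q (Function.update a i x) = q i x * ∏ j ∈ univ.erase i, q j (a j) := by
      unfold prodMeas
      rw [← Finset.mul_prod_erase univ _ (mem_univ i)]
      congr 1
      · simp
      · refine Finset.prod_congr rfl fun j hj => ?_
        rw [Function.update_of_ne (Finset.ne_of_mem_erase hj)]
    rw [h1, h2]; ring
  have hinv : Function.Involutive
      (fun z : K × (Fin n → K) => (z.2 i, Function.update z.2 i z.1)) := by
    rintro ⟨x, a⟩
    simp
  calc ∑ a, prodMeas q a * f a
      = ∑ z : K × (Fin n → K), q i z.1 * prodMeas q z.2 * f z.2 := by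
        rw [Fintype.sum_prod_type]
        simp_rw [mul_assoc, ← Finset.mul_sum]
        rw [← Finset.sum_mul, hq, one_mul]
    _ = ∑ z : K × (Fin n → K), q i (z.2 i) * prodMeas q (Function.update z.2 i z.1)
          * f (Function.update z.2 i z.1) :=
        (Equiv.sum_comp (Function.Involutive.toPerm _ hinv)
          (fun z : K × (Fin n → K) => q i z.1 * prodMeas q z.2 * f z.2)).symm
    _ = _ := by
        rw [Fintype.sum_prod_type]
        refine Finset.sum_congr rfl fun x _ => ?_
        rw [Finset.mul_sum]
        exact Finset.sum_congr rfl fun a _ => by rw [← key, mul_assoc]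

theorem smeas_eq_sum_mul (q : Fin n → K → ℝ) (A : Set (Fin n → K)) :
    smeas (prodMeas q) A = ∑ a, prodMeas q a * A.indicator 1 a := by
  unfold smeas
  refine Finset.sum_congr rfl fun a _ => ?_
  by_cases h : a ∈ A <;> simp [h]

/-- The section of `A` in which coordinate `i` is set to `x`. -/
def sect (i : Fin n) (x : K) (A : Set (Fin n → K)) : Set (Fin n → K) :=
  {a | Function.update a i x ∈ A}

theorem smeas_eq_sum_sect {q : Fin n → K → ℝ} (i : Fin n) (hq : ∑ x, q i x = 1)
    (A : Set (Fin n → K)) :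
    smeas (prodMeas q) A = ∑ x, q i x * smeas (prodMeas q) (sect i x A) := by
  simp_rw [smeas_eq_sum_mul]
  rw [sum_prodMeas_update i hq]
  rfl

theorem smeas_nonneg {q : Fin n → K → ℝ} (hq : ∀ i x, 0 ≤ q i x) (A : Set (Fin n → K)) :
    0 ≤ smeas (prodMeas q) A :=
  Finset.sum_nonneg fun a _ => Set.indicator_nonneg (fun a _ => prodMeas_nonneg hq a) a

theorem smeas_mono {q : Fin n → K → ℝ} (hq : ∀ i x, 0 ≤ q i x) {A B : Set (Fin n → K)}
    (h : A ⊆ B) : smeas (prodMeas q) A ≤ smeas (prodMeas q) B :=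
  Finset.sum_le_sum fun a _ =>
    Set.indicator_le_indicator_of_subset h (fun a => prodMeas_nonneg hq a) a

theorem smeas_univ {q : Fin n → K → ℝ} (hq : ∀ i, ∑ x, q i x = 1) :
    smeas (prodMeas q) Set.univ = 1 := by
  simp [smeas, sum_prodMeas hq]

theorem smeas_empty (q : Fin n → K → ℝ) : smeas (prodMeas q) ∅ = 0 := by
  simp [smeas]

theorem smeas_le_one {q : Fin n → K → ℝ} (hq : ∀ i x, 0 ≤ q i x) (hq1 : ∀ i, ∑ x, q i x = 1)
    (A : Set (Fin n → K)) : smeas (prodMeas q) A ≤ 1 :=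
  smeas_univ hq1 ▸ smeas_mono hq (Set.subset_univ A)

theorem smeas_union_add_inter (q : Fin n → K → ℝ) (A B : Set (Fin n → K)) :
    smeas (prodMeas q) (A ∪ B) + smeas (prodMeas q) (A ∩ B)
      = smeas (prodMeas q) A + smeas (prodMeas q) B := by
  unfold smeas
  rw [← Finset.sum_add_distrib, ← Finset.sum_add_distrib]
  exact Finset.sum_congr rfl fun a _ => Set.indicator_union_add_inter_apply _ A B a

theorem smeas_union_le {q : Fin n → K → ℝ} (hq : ∀ i x, 0 ≤ q i x) (A B : Set (Fin n → K)) :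
    smeas (prodMeas q) (A ∪ B) ≤ smeas (prodMeas q) A + smeas (prodMeas q) B := by
  have := smeas_union_add_inter q A B
  have := smeas_nonneg hq (A ∩ B)
  linarith

theorem smeas_iUnion_le {q : Fin n → K → ℝ} (hq : ∀ i x, 0 ≤ q i x) {ι : Type*}
    (s : Finset ι) (A : ι → Set (Fin n → K)) :
    smeas (prodMeas q) (⋃ t ∈ s, A t) ≤ ∑ t ∈ s, smeas (prodMeas q) (A t) := by
  classical
  induction s using Finset.induction_on with
  | empty => simp [smeas_empty]
  | insert t s ht ih =>
    rw [Finset.sum_insert ht, Finset.set_biUnion_insert]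
    exact (smeas_union_le hq _ _).trans (by linarith)

/-- The measure of a set pushed forward along a map of alphabets. -/
theorem smeas_pushforward {Y : Type*} [Fintype Y] (f : K → Y) (q : Fin n → K → ℝ)
    (p : Fin n → Y → ℝ)
    (hp : ∀ i y, p i y = ∑ x, ({x' | f x' = y} : Set K).indicator (q i) x)
    (A : Set (Fin n → Y)) :
    smeas (prodMeas p) A = smeas (prodMeas q) {a | (fun i => f (a i)) ∈ A} := by
  classical
  have h1 : ∀ b : Fin n → Y,
      prodMeas p b = ∑ a : Fin n → K, if (fun i => f (a i)) = b then prodMeas q a else 0 := by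
    intro b
    unfold prodMeas
    simp_rw [hp]
    rw [Finset.prod_univ_sum, Fintype.piFinset_univ]
    refine Finset.sum_congr rfl fun a _ => ?_
    simp only [Set.indicator_apply, Set.mem_ofPred_eq]
    rw [Finset.prod_ite_zero]
    simp [funext_iff]
  unfold smeas
  simp only [Set.indicator_apply, Set.mem_ofPred_eq, h1]
  have h2 : ∀ b : Fin n → Y, (if b ∈ A then
      (∑ a : Fin n → K, if (fun i => f (a i)) = b then prodMeas q a else 0) else 0)
      = ∑ a : Fin n → K, if (fun i => f (a i)) = b then
          (if b ∈ A then prodMeas q a else 0) else 0 := by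
    intro b
    by_cases hb : b ∈ A <;> simp [hb]
  simp_rw [h2]
  rw [Finset.sum_comm]
  exact Finset.sum_congr rfl fun a _ => by simp

theorem smeas_le_mul_smeas {q q' : Fin n → K → ℝ} (hq' : ∀ i x, 0 ≤ q' i x) (e : Fin n → ℝ)
    (h : ∀ i x, q' i x ≤ Real.exp (e i) * q i x) (A : Set (Fin n → K)) :
    smeas (prodMeas q') A ≤ Real.exp (∑ i, e i) * smeas (prodMeas q) A := by
  unfold smeas
  rw [Finset.mul_sum]
  refine Finset.sum_le_sum fun a _ => ?_
  by_cases ha : a ∈ A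
  · simp only [Set.indicator_of_mem ha, prodMeas]
    rw [Real.exp_sum, ← Finset.prod_mul_distrib]
    exact Finset.prod_le_prod (fun i _ => hq' i (a i)) fun i _ => h i (a i)
  · simp [ha]

end Measure

section ReverseHypercontractivity

variable {n : ℕ} {K : Type*}

/-- `A` depends only on the `r`-classes of the coordinates in `I`. -/
def Determined (r : Setoid K) (I : Finset (Fin n)) (A : Set (Fin n → K)) : Prop :=
  ∀ a b : Fin n → K, (∀ i ∈ I, r (a i) (b i)) → a ∈ A → b ∈ A

theorem Determined.sect {r : Setoid K} {I : Finset (Fin n)} {A : Set (Fin n → K)} {i : Fin n}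
    (h : Determined r (insert i I) A) (x : K) : Determined r I (sect i x A) := by
  intro a b hab ha
  refine h _ _ (fun j hj => ?_) ha
  by_cases hji : j = i
  · subst hji; simp
  · simpa [hji] using hab j (Finset.mem_of_mem_insert_of_ne hj hji)

theorem Determined.sect_univ {r : Setoid K} {A : Set (Fin n → K)} (i : Fin n)
    (h : Determined r univ A) (x : K) : Determined r univ (_root_.sect i x A) :=
  Determined.sect (by simpa using h) x

theorem Determined.union {r : Setoid K} {I : Finset (Fin n)} {A B : Set (Fin n → K)}
    (hA : Determined r I A) (hB : Determined r I B) : Determined r I (A ∪ B) :=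
  fun a b hab h => h.imp (hA a b hab) (hB a b hab)

theorem Determined.inter {r : Setoid K} {I : Finset (Fin n)} {A B : Set (Fin n → K)}
    (hA : Determined r I A) (hB : Determined r I B) : Determined r I (A ∩ B) :=
  fun a b hab h => ⟨hA a b hab h.1, hB a b hab h.2⟩

theorem Determined.sect_congr {r : Setoid K} {I : Finset (Fin n)} {A : Set (Fin n → K)}
    (h : Determined r I A) (i : Fin n) {x y : K} (hxy : r x y) :
    _root_.sect i x A = _root_.sect i y A := by
  have aux : ∀ x y : K, r x y → _root_.sect i x A ⊆ _root_.sect i y A := by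
    intro x y hxy a ha
    refine h _ _ (fun j _ => ?_) ha
    by_cases hji : j = i
    · subst hji; simpa using hxy
    · simp [hji]
  exact (aux x y hxy).antisymm (aux y x (r.symm hxy))

theorem Determined.eq_empty_or_univ {r : Setoid K} {A : Set (Fin n → K)}
    (h : Determined r ∅ A) : A = ∅ ∨ A = Set.univ := by
  rcases A.eq_empty_or_nonempty with h0 | ⟨a, ha⟩
  · exact Or.inl h0
  · exact Or.inr (Set.eq_univ_of_forall fun b => h a b (by simp) ha)

variable [Fintype K]

/-- Product measures whose weights agree on `r`-invariant functions agree on `r`-determined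
sets. -/
theorem smeas_eq_of_determined {r : Setoid K} {q q' : Fin n → K → ℝ}
    (hq : ∀ i, ∑ x, q i x = 1) (hq' : ∀ i, ∑ x, q' i x = 1)
    (h : ∀ i (f : K → ℝ), (∀ x y, r x y → f x = f y) → ∑ x, q' i x * f x = ∑ x, q i x * f x)
    (I : Finset (Fin n)) :
    ∀ A : Set (Fin n → K), Determined r I A →
      smeas (prodMeas q') A = smeas (prodMeas q) A := by
  induction I using Finset.induction_on with
  | empty =>
    intro A hA
    rcases hA.eq_empty_or_univ with rfl | rfl
    · simp [smeas_empty]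
    · rw [smeas_univ hq, smeas_univ hq']
  | insert i I _ ih =>
    intro A hA
    rw [smeas_eq_sum_sect i (hq i), smeas_eq_sum_sect i (hq' i)]
    simp_rw [fun x => ih _ (hA.sect x)]
    exact h i _ fun x y hxy => by rw [hA.sect_congr i hxy]

theorem exists_le_of_sum_eq {q f : K → ℝ} {α : ℝ} (hq : ∀ x, 0 ≤ q x) (hq1 : ∑ x, q x = 1)
    (hf : ∑ x, q x * f x = α) : ∃ x, α ≤ f x := by
  by_contra! hlt
  have hne : ∃ x ∈ (univ : Finset K), q x ≠ 0 :=
    Finset.exists_ne_zero_of_sum_ne_zero (by rw [hq1]; exact one_ne_zero)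
  obtain ⟨x, -, hx⟩ := hne
  have : ∑ x, q x * f x < ∑ x, q x * α :=
    Finset.sum_lt_sum (fun y _ => mul_le_mul_of_nonneg_left (hlt y).le (hq y))
      ⟨x, mem_univ x, mul_lt_mul_of_pos_left (hlt x) (lt_of_le_of_ne (hq x) (Ne.symm hx))⟩
  rw [← Finset.sum_mul, hq1, one_mul, hf] at this
  exact lt_irrefl _ this

theorem le_of_sum_eq_of_le {q f : K → ℝ} {α κ t : ℝ} (hκ : 0 < κ) (hq : ∀ x, κ ≤ q x)
    (hq1 : ∑ x, q x = 1) (hf : ∑ x, q x * f x = α) (hα : 0 ≤ α) (ht : 0 ≤ t)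
    (hle : ∀ x, f x ≤ (1 + κ * t) * α) (y : K) : (1 - t) * α ≤ f y := by
  classical
  have h1 := Finset.add_sum_erase univ (fun x => q x * f x) (mem_univ y)
  have h2 := Finset.add_sum_erase univ q (mem_univ y)
  have h3 : ∑ x ∈ univ.erase y, q x * f x ≤ ∑ x ∈ univ.erase y, q x * ((1 + κ * t) * α) :=
    Finset.sum_le_sum fun x _ => mul_le_mul_of_nonneg_left (hle x) (hκ.le.trans (hq x))
  rw [← Finset.sum_mul] at h3
  have h4 : ∑ x ∈ univ.erase y, q x = 1 - q y := by linarith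
  rw [h4] at h3
  have hqy := hq y
  have h5 : q y * ((1 - t) * α) ≤ q y * f y := by
    have h7 : 0 ≤ (q y - κ) * (t * α) := mul_nonneg (by linarith) (mul_nonneg ht hα)
    have h8 : 0 ≤ q y * κ * (t * α) :=
      mul_nonneg (mul_nonneg (by linarith) hκ.le) (mul_nonneg ht hα)
    nlinarith
  exact le_of_mul_le_mul_left h5 (by linarith)

theorem exp_sub_sq_le {g : ℝ} (h : -(1 / 2) ≤ g) :
    Real.exp (g - 2 * g ^ 2) ≤ 1 + g := by
  have hpos : 0 < 1 + g := by linarith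
  rw [← Real.le_log_iff_exp_le hpos]
  refine le_trans ?_ (Real.one_sub_inv_le_log_of_pos hpos)
  have h1 : 1 - (1 + g)⁻¹ - (g - 2 * g ^ 2) = g ^ 2 * (1 + 2 * g) / (1 + g) := by
    field_simp
    ring
  have h2 : 0 ≤ g ^ 2 * (1 + 2 * g) / (1 + g) :=
    div_nonneg (mul_nonneg (sq_nonneg g) (by linarith)) hpos.le
  linarith

/-- The one-coordinate inequality behind the correlation bound, for normalised functions. -/
theorem one_sub_le_sum_mul_prod_pow {T : Type*} [Fintype T] {r : T → Setoid K}
    (hr : ∀ y : T → K, ∃ x, ∀ t, r t (y t) x) {κ s : ℝ} (hκ : 0 < κ) (hs : 0 < s)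
    (hs2 : s ≤ 1 / 2) {N : ℕ} (hN : 1 ≤ κ * (1 + κ * s) ^ N) {q : K → ℝ} (hq : ∀ x, κ ≤ q x)
    (hq1 : ∑ x, q x = 1) {f : T → K → ℝ} (hf0 : ∀ t x, 0 ≤ f t x)
    (hf : ∀ t x y, r t x y → f t x = f t y) (hf1 : ∀ t, ∑ x, q x * f t x = 1) :
    1 - N * Fintype.card T * (2 * s ^ 2) ≤ ∑ x, q x * ∏ t, f t x ^ N := by
  have hq0 : ∀ x, 0 ≤ q x := fun x => hκ.le.trans (hq x)
  have hκ1 : ∀ x, κ ≤ 1 := fun x =>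
    (hq x).trans (hq1 ▸ Finset.single_le_sum (fun y _ => hq0 y) (mem_univ x))
  by_cases hcase : ∃ t y, 1 + κ * s < f t y
  · obtain ⟨t₀, y₀, h₀⟩ := hcase
    have hmax : ∀ t, ∃ y, 1 ≤ f t y ∧ (t = t₀ → 1 + κ * s ≤ f t y) := by
      intro t
      by_cases ht : t = t₀
      · subst ht
        exact ⟨y₀, by nlinarith [mul_pos hκ hs], fun _ => h₀.le⟩
      · obtain ⟨y, hy⟩ := exists_le_of_sum_eq hq0 hq1 (hf1 t)
        exact ⟨y, hy, fun h => absurd h ht⟩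
    choose y hy1 hy2 using hmax
    obtain ⟨x, hx⟩ := hr y
    have hprod : (1 + κ * s) ^ N ≤ ∏ t, f t x ^ N := by
      classical
      rw [← Finset.mul_prod_erase univ _ (mem_univ t₀)]
      have h1 : (1 + κ * s) ^ N ≤ f t₀ x ^ N := by
        have : 1 + κ * s ≤ f t₀ x := hf t₀ _ _ (hx t₀) ▸ hy2 t₀ rfl
        gcongr
      have h2 : 1 ≤ ∏ t ∈ univ.erase t₀, f t x ^ N := by
        calc (1 : ℝ) = ∏ t ∈ univ.erase t₀, 1 := by simp
          _ ≤ _ := Finset.prod_le_prod (by simp) fun t _ =>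
            one_le_pow₀ (hf t _ _ (hx t) ▸ hy1 t)
      have h3 : (0:ℝ) ≤ f t₀ x ^ N := pow_nonneg (hf0 _ _) _
      nlinarith
    have h4 : q x * ∏ t, f t x ^ N ≤ ∑ x, q x * ∏ t, f t x ^ N :=
      Finset.single_le_sum (f := fun x => q x * ∏ t, f t x ^ N)
        (fun z _ => mul_nonneg (hq0 z) (Finset.prod_nonneg fun t _ => pow_nonneg (hf0 t z) N))
        (mem_univ x)
    have h5 : κ * (1 + κ * s) ^ N ≤ q x * ∏ t, f t x ^ N :=
      mul_le_mul (hq x) hprod (by positivity) (hq0 x)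
    have h6 : (0:ℝ) ≤ N * Fintype.card T * (2 * s ^ 2) := by positivity
    linarith
  · push Not at hcase
    have hlow : ∀ t y, 1 - s ≤ f t y := fun t y => by
      simpa using le_of_sum_eq_of_le hκ hq hq1 (hf1 t) zero_le_one hs.le
        (fun x => by simpa using hcase t x) y
    have hterm : ∀ x, 1 + ∑ t, N * ((f t x - 1) - 2 * s ^ 2) ≤ ∏ t, f t x ^ N := by
      intro x
      have hup : ∀ t, f t x ≤ 1 + s := fun t =>
        (hcase t x).trans (by nlinarith [hκ1 x])
      calc 1 + ∑ t, N * ((f t x - 1) - 2 * s ^ 2)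
          ≤ Real.exp (∑ t, N * ((f t x - 1) - 2 * s ^ 2)) := by
            rw [add_comm]; exact Real.add_one_le_exp _
        _ = ∏ t, Real.exp ((f t x - 1) - 2 * s ^ 2) ^ N := by
            rw [Real.exp_sum]
            exact Finset.prod_congr rfl fun t _ => by rw [← Real.exp_nat_mul]
        _ ≤ ∏ t, f t x ^ N := by
            refine Finset.prod_le_prod (fun t _ => by positivity) fun t _ => ?_
            have h1 := hlow t x
            have h2 := hup t
            have h3 : Real.exp ((f t x - 1) - 2 * s ^ 2) ≤ f t x := by
              have h4 := exp_sub_sq_le (g := f t x - 1) (by linarith)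
              refine le_trans (Real.exp_le_exp.2 ?_) (h4.trans (by linarith))
              nlinarith
            gcongr
    calc 1 - N * Fintype.card T * (2 * s ^ 2)
        = ∑ x, q x * (1 + ∑ t, N * ((f t x - 1) - 2 * s ^ 2)) := by
          simp_rw [mul_add, Finset.mul_sum]
          rw [Finset.sum_add_distrib, Finset.sum_comm]
          have : ∀ t, ∑ x, q x * (N * ((f t x - 1) - 2 * s ^ 2)) = - (N * (2 * s ^ 2)) := by
            intro t
            calc ∑ x, q x * (N * ((f t x - 1) - 2 * s ^ 2))
                = N * ∑ x, q x * f t x - N * (1 + 2 * s ^ 2) * ∑ x, q x := by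
                  rw [Finset.mul_sum, Finset.mul_sum, ← Finset.sum_sub_distrib]
                  exact Finset.sum_congr rfl fun x _ => by ring
              _ = _ := by rw [hf1, hq1]; ring
          simp only [this, mul_one, hq1, Finset.sum_const, Finset.card_univ, nsmul_eq_mul]
          ring
      _ ≤ _ := Finset.sum_le_sum fun x _ => mul_le_mul_of_nonneg_left (hterm x) (hq0 x)

theorem mul_prod_pow_le_sum_mul_prod_pow {T : Type*} [Fintype T] {r : T → Setoid K}
    (hr : ∀ y : T → K, ∃ x, ∀ t, r t (y t) x) {κ s : ℝ} (hκ : 0 < κ) (hs : 0 < s)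
    (hs2 : s ≤ 1 / 2) {N : ℕ} (hN0 : N ≠ 0) (hN : 1 ≤ κ * (1 + κ * s) ^ N) {q : K → ℝ}
    (hq : ∀ x, κ ≤ q x) (hq1 : ∑ x, q x = 1) {f : T → K → ℝ} (hf0 : ∀ t x, 0 ≤ f t x)
    (hf : ∀ t x y, r t x y → f t x = f t y) :
    (1 - N * Fintype.card T * (2 * s ^ 2)) * ∏ t, (∑ x, q x * f t x) ^ N
      ≤ ∑ x, q x * ∏ t, f t x ^ N := by
  have hq0 : ∀ x, 0 ≤ q x := fun x => hκ.le.trans (hq x)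
  have hm0 : ∀ t, 0 ≤ ∑ x, q x * f t x := fun t =>
    Finset.sum_nonneg fun x _ => mul_nonneg (hq0 x) (hf0 t x)
  by_cases hz : ∃ t, ∑ x, q x * f t x = 0
  · obtain ⟨t, ht⟩ := hz
    rw [Finset.prod_eq_zero (mem_univ t) (by rw [ht, zero_pow hN0]), mul_zero]
    exact Finset.sum_nonneg fun x _ =>
      mul_nonneg (hq0 x) (Finset.prod_nonneg fun t _ => pow_nonneg (hf0 t x) N)
  · push Not at hz
    have h := one_sub_le_sum_mul_prod_pow hr hκ hs hs2 hN hq hq1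
      (f := fun t x => f t x / ∑ x, q x * f t x) (fun t x => div_nonneg (hf0 t x) (hm0 t))
      (fun t x y hxy => by simp only [hf t x y hxy])
      (fun t => by
        simp_rw [← mul_div_assoc]
        rw [← Finset.sum_div, div_self (hz t)])
    have hpos : 0 < ∏ t, (∑ x, q x * f t x) ^ N :=
      Finset.prod_pos fun t _ => pow_pos (lt_of_le_of_ne (hm0 t) (Ne.symm (hz t))) N
    simp_rw [div_pow, Finset.prod_div_distrib, ← mul_div_assoc] at h
    rwa [← Finset.sum_div, le_div_iff₀ hpos] at h

theorem pow_mul_prod_pow_le_smeas_iInter {T : Type*} [Fintype T] {r : T → Setoid K}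
    (hr : ∀ y : T → K, ∃ x, ∀ t, r t (y t) x) {κ s : ℝ} (hκ : 0 < κ) (hs : 0 < s)
    (hs2 : s ≤ 1 / 2) {N : ℕ} (hN0 : N ≠ 0) (hN : 1 ≤ κ * (1 + κ * s) ^ N)
    (hlam : 0 ≤ 1 - N * Fintype.card T * (2 * s ^ 2)) {q : Fin n → K → ℝ} (hq : ∀ i x, κ ≤ q i x)
    (hq1 : ∀ i, ∑ x, q i x = 1) (I : Finset (Fin n)) :
    ∀ A : T → Set (Fin n → K), (∀ t, Determined (r t) I (A t)) →
      (1 - N * Fintype.card T * (2 * s ^ 2)) ^ I.card * ∏ t, smeas (prodMeas q) (A t) ^ N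
        ≤ smeas (prodMeas q) {a | ∀ t, a ∈ A t} := by
  have hq0 : ∀ i x, 0 ≤ q i x := fun i x => hκ.le.trans (hq i x)
  induction I using Finset.induction_on with
  | empty =>
    intro A hA
    by_cases hE : ∃ t, A t = ∅
    · obtain ⟨t, ht⟩ := hE
      rw [Finset.prod_eq_zero (mem_univ t) (by rw [ht, smeas_empty, zero_pow hN0]), mul_zero]
      exact smeas_nonneg hq0 _
    · push Not at hE
      have hU : ∀ t, A t = Set.univ := fun t =>
        (hA t).eq_empty_or_univ.resolve_left (Set.nonempty_iff_ne_empty.1 (hE t))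
      simp [hU, smeas_univ hq1]
  | insert i I hi ih =>
    intro A hA
    rw [smeas_eq_sum_sect i (hq1 i), Finset.card_insert_of_notMem hi, pow_succ]
    simp_rw [fun t => smeas_eq_sum_sect i (hq1 i) (A t)]
    have h1 := mul_prod_pow_le_sum_mul_prod_pow hr hκ hs hs2 hN0 hN (hq i) (hq1 i)
      (f := fun t x => smeas (prodMeas q) (sect i x (A t))) (fun t x => smeas_nonneg hq0 _)
      (fun t x y hxy => by simp only [(hA t).sect_congr i hxy])
    have h2 : ∀ x, (1 - N * Fintype.card T * (2 * s ^ 2)) ^ I.card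
        * ∏ t, smeas (prodMeas q) (sect i x (A t)) ^ N
        ≤ smeas (prodMeas q) (sect i x {a | ∀ t, a ∈ A t}) := fun x =>
      ih (fun t => sect i x (A t)) fun t => (hA t).sect x
    rw [mul_assoc]
    calc _ ≤ (1 - N * Fintype.card T * (2 * s ^ 2)) ^ I.card
          * ∑ x, q i x * ∏ t, smeas (prodMeas q) (sect i x (A t)) ^ N :=
          mul_le_mul_of_nonneg_left h1 (pow_nonneg hlam _)
      _ = ∑ x, q i x * ((1 - N * Fintype.card T * (2 * s ^ 2)) ^ I.card
          * ∏ t, smeas (prodMeas q) (sect i x (A t)) ^ N) := by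
          rw [Finset.mul_sum]; exact Finset.sum_congr rfl fun x _ => by ring
      _ ≤ _ := Finset.sum_le_sum fun x _ => mul_le_mul_of_nonneg_left (h2 x) (hq0 i x)

/-- Exponentially large sets depending on complementary parts of the alphabet have an
exponentially large intersection, with arbitrarily small extra exponential loss `ρ`. -/
theorem exists_exp_mul_prod_pow_le_smeas {κ ρ : ℝ} (hκ : 0 < κ) (hκ1 : κ ≤ 1) (hρ : 0 < ρ)
    (C : ℕ) : ∃ N : ℕ, ∀ {n : ℕ} {K T : Type} [Fintype K] [Fintype T], Fintype.card T ≤ C →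
      ∀ {r : T → Setoid K}, (∀ y : T → K, ∃ x, ∀ t, r t (y t) x) →
      ∀ {q : Fin n → K → ℝ}, (∀ i x, κ ≤ q i x) → (∀ i, ∑ x, q i x = 1) →
      ∀ A : T → Set (Fin n → K), (∀ t, Determined (r t) univ (A t)) →
        Real.exp (-ρ * n) * ∏ t, smeas (prodMeas q) (A t) ^ N
          ≤ smeas (prodMeas q) {a | ∀ t, a ∈ A t} := by
  obtain ⟨s, hs, hs2, hsC⟩ : ∃ s : ℝ, 0 < s ∧ s ≤ 1 / 2 ∧
      4 / κ ^ 2 * C * s ≤ min (ρ / 2) (1 / 2) := by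
    refine ⟨min (1 / 2) (min (ρ / 2) (1 / 2) / (4 / κ ^ 2 * (C + 1))), by positivity,
      min_le_left _ _, ?_⟩
    calc 4 / κ ^ 2 * C * min (1 / 2) (min (ρ / 2) (1 / 2) / (4 / κ ^ 2 * (C + 1)))
        ≤ 4 / κ ^ 2 * (C + 1) * (min (ρ / 2) (1 / 2) / (4 / κ ^ 2 * (C + 1))) := by
          gcongr
          · linarith
          · exact min_le_right _ _
      _ = _ := by field_simp
  set N : ℕ := ⌈1 / (κ ^ 2 * s)⌉₊ with hNdef
  have hN1 : 1 / (κ ^ 2 * s) ≤ N := Nat.le_ceil _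
  have hN0 : N ≠ 0 := (Nat.ceil_pos.2 (by positivity)).ne'
  have hN2 : (N : ℝ) ≤ 2 / (κ ^ 2 * s) := by
    have h1 : (N : ℝ) < 1 / (κ ^ 2 * s) + 1 := Nat.ceil_lt_add_one (by positivity)
    have h2 : 1 ≤ 1 / (κ ^ 2 * s) := by
      rw [le_div_iff₀ (by positivity)]
      have : κ ^ 2 ≤ 1 := pow_le_one₀ hκ.le hκ1
      nlinarith
    have h3 : 2 / (κ ^ 2 * s) = 1 / (κ ^ 2 * s) + 1 / (κ ^ 2 * s) := by ring
    linarith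
  have hN : 1 ≤ κ * (1 + κ * s) ^ N := by
    have h1 := one_add_mul_le_pow (a := κ * s) (by nlinarith [mul_pos hκ hs]) N
    have h2 : 1 ≤ κ * (1 + N * (κ * s)) := by
      have h3 : 1 ≤ (N : ℝ) * (κ ^ 2 * s) := by
        rwa [div_le_iff₀ (by positivity)] at hN1
      nlinarith
    exact h2.trans (mul_le_mul_of_nonneg_left h1 hκ.le)
  refine ⟨N, ?_⟩
  intro n K T _ _ hT r hr q hq hq1 A hA
  have hloss : N * Fintype.card T * (2 * s ^ 2) ≤ min (ρ / 2) (1 / 2) := by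
    calc N * Fintype.card T * (2 * s ^ 2) ≤ 2 / (κ ^ 2 * s) * C * (2 * s ^ 2) := by gcongr
      _ = 4 / κ ^ 2 * C * s := by field_simp; ring
      _ ≤ _ := hsC
  have hl1 := hloss.trans (min_le_left _ _)
  have hl2 := hloss.trans (min_le_right _ _)
  set l : ℝ := N * Fintype.card T * (2 * s ^ 2) with hl
  have hl0 : 0 ≤ l := by positivity
  have hexp : Real.exp (-ρ * n) ≤ (1 - l) ^ n := by
    have h1 : Real.exp (-ρ) ≤ 1 - l := by
      have h2 := exp_sub_sq_le (g := -l) (by linarith)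
      refine (Real.exp_le_exp.2 ?_).trans (h2.trans (by linarith))
      nlinarith
    calc Real.exp (-ρ * n) = Real.exp (-ρ) ^ n := by rw [← Real.exp_nat_mul]; ring_nf
      _ ≤ _ := by gcongr
  have hmain := pow_mul_prod_pow_le_smeas_iInter hr hκ hs hs2 hN0 hN (by linarith) hq hq1 univ
    A hA
  rw [Finset.card_univ, Fintype.card_fin] at hmain
  refine le_trans (mul_le_mul_of_nonneg_right hexp ?_) hmain
  exact Finset.prod_nonneg fun t _ =>
    pow_nonneg (smeas_nonneg (fun i x => hκ.le.trans (hq i x)) _) _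

end ReverseHypercontractivity

section Transfers

variable {n D : ℕ} {K : Type*}

/-- The points `a ∈ A` for which the coordinates of the array outside `I` sum to `w`. -/
def levelSet (V : Fin n → K → Fin D → ℤ) (I : Finset (Fin n)) (A : Set (Fin n → K))
    (w : Fin D → ℤ) : Set (Fin n → K) :=
  {a | a ∈ A ∧ ∑ i ∈ Iᶜ, V i (a i) = w}

/-- `u` is a transfer for `v` with respect to the two-part splitting of the alphabet given by
`rA` and `rB`. -/
def HasTransfer (rA rB : Setoid K) (v : K → Fin D → ℤ) (u : Fin D → ℤ) : Prop :=
  ∃ x x' y y' : K, rA x y ∧ rA x' y' ∧ rB x x' ∧ rB y y' ∧ v x - v x' = u ∧ v y = v y'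

theorem sect_levelSet (V : Fin n → K → Fin D → ℤ) {I : Finset (Fin n)} {i : Fin n} (hi : i ∉ I)
    (x : K) (A : Set (Fin n → K)) (w : Fin D → ℤ) :
    sect i x (levelSet V I A w) = levelSet V (insert i I) (sect i x A) (w - V i x) := by
  ext a
  have h : ∑ j ∈ Iᶜ, V j (Function.update a i x j)
      = V i x + ∑ j ∈ (insert i I)ᶜ, V j (a j) := by
    rw [← Finset.add_sum_erase Iᶜ _ (Finset.mem_compl.2 hi), Finset.compl_insert]
    congr 1
    · simp
    · exact Finset.sum_congr rfl fun j hj => by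
        rw [Function.update_of_ne (Finset.ne_of_mem_erase hj)]
  show (_ ∧ _) ↔ (_ ∧ _)
  rw [h, eq_sub_iff_add_eq, add_comm]
  rfl

variable [Fintype K]

theorem mul_smeas_levelSet_le {q : Fin n → K → ℝ} {κ : ℝ} (hκ : 0 < κ) (hq : ∀ i x, κ ≤ q i x)
    (hq1 : ∀ i, ∑ x, q i x = 1) (V : Fin n → K → Fin D → ℤ) {I : Finset (Fin n)} {i : Fin n}
    (hi : i ∉ I) (x : K) (A : Set (Fin n → K)) (w : Fin D → ℤ) :
    κ * smeas (prodMeas q) (levelSet V (insert i I) (sect i x A) (w - V i x))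
      ≤ smeas (prodMeas q) (levelSet V I A w) := by
  have hq0 : ∀ i x, 0 ≤ q i x := fun i x => hκ.le.trans (hq i x)
  rw [smeas_eq_sum_sect i (hq1 i) (levelSet V I A w), ← sect_levelSet V hi]
  exact (mul_le_mul_of_nonneg_right (hq i x) (smeas_nonneg hq0 _)).trans
    (Finset.single_le_sum (f := fun x => q i x * smeas (prodMeas q) (sect i x (levelSet V I A w)))
      (fun z _ => mul_nonneg (hq0 i z) (smeas_nonneg hq0 _)) (mem_univ x))

theorem mul_smeas_levelSet_union_le {q : Fin n → K → ℝ} {κ : ℝ} (hκ : 0 < κ)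
    (hq : ∀ i x, κ ≤ q i x) (hq1 : ∀ i, ∑ x, q i x = 1) (V : Fin n → K → Fin D → ℤ)
    {I : Finset (Fin n)} {i : Fin n} (hi : i ∉ I) {y y' : K} (hy : V i y = V i y')
    (A : Set (Fin n → K)) (w : Fin D → ℤ) :
    κ * smeas (prodMeas q) (levelSet V (insert i I) (sect i y A ∪ sect i y' A) (w - V i y))
      ≤ smeas (prodMeas q) (levelSet V I A w) := by
  classical
  have hq0 : ∀ i x, 0 ≤ q i x := fun i x => hκ.le.trans (hq i x)
  by_cases hyy : y = y'
  · subst hyy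
    rw [Set.union_self]
    exact mul_smeas_levelSet_le hκ hq hq1 V hi y A w
  · rw [smeas_eq_sum_sect i (hq1 i) (levelSet V I A w)]
    have hsub : levelSet V (insert i I) (sect i y A ∪ sect i y' A) (w - V i y)
        ⊆ sect i y (levelSet V I A w) ∪ sect i y' (levelSet V I A w) := by
      rw [sect_levelSet V hi, sect_levelSet V hi, ← hy]
      rintro a ⟨ha | ha, h⟩
      · exact Or.inl ⟨ha, h⟩
      · exact Or.inr ⟨ha, h⟩
    have h1 := (smeas_mono hq0 hsub).trans (smeas_union_le hq0 _ _)
    have h2 : ∑ x ∈ {y, y'}, q i x * smeas (prodMeas q) (sect i x (levelSet V I A w))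
        ≤ ∑ x, q i x * smeas (prodMeas q) (sect i x (levelSet V I A w)) :=
      Finset.sum_le_sum_of_subset_of_nonneg (Finset.subset_univ _)
        fun z _ _ => mul_nonneg (hq0 i z) (smeas_nonneg hq0 _)
    rw [Finset.sum_pair hyy] at h2
    have h3 := mul_le_mul_of_nonneg_right (hq i y)
      (smeas_nonneg hq0 (sect i y (levelSet V I A w)))
    have h4 := mul_le_mul_of_nonneg_right (hq i y')
      (smeas_nonneg hq0 (sect i y' (levelSet V I A w)))
    have h5 := mul_le_mul_of_nonneg_left h1 hκ.le
    linarith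

theorem exp_half_le {t : ℝ} (h0 : 0 ≤ t) (h1 : t ≤ 1) : Real.exp (t / 2) ≤ 1 + t := by
  have h2 := Real.add_one_le_exp (-(t / 2))
  have h3 : Real.exp (t / 2) * Real.exp (-(t / 2)) = 1 := by
    rw [← Real.exp_add]; simp
  have h5 : Real.exp (t / 2) * (1 - t / 2) ≤ 1 := by nlinarith
  have h6 : 1 ≤ (1 + t) * (1 - t / 2) := by nlinarith
  exact le_of_mul_le_mul_right (h5.trans h6) (by linarith)

/-- Fixing one coordinate either increases the density of the two sets, or loses little density
while allowing the target to be shifted by the transfer vector. -/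
theorem exists_section_step {q : Fin n → K → ℝ} {κ c : ℝ} (hκ : 0 < κ) (hκ1 : κ ≤ 1)
    (hc : 0 < c) (hc1 : c ≤ 1 / 4) (hq : ∀ i x, κ ≤ q i x) (hq1 : ∀ i, ∑ x, q i x = 1)
    {rA rB : Setoid K} (hr : ∀ x y, ∃ z, rA x z ∧ rB y z) {V : Fin n → K → Fin D → ℤ}
    {R : Fin D → ℝ} (hV : ∀ i x d, |(V i x d : ℝ)| ≤ R d) {I : Finset (Fin n)} {i : Fin n}
    (hi : i ∉ I) {u : Fin D → ℤ} (hu : HasTransfer rA rB (V i) u) {A B : Set (Fin n → K)}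
    (hA : Determined rA univ A) (hB : Determined rB univ B) :
    ∃ (A' B' : Set (Fin n → K)) (v : Fin D → ℤ), Determined rA univ A' ∧
      Determined rB univ B' ∧ (∀ d, |(v d : ℝ)| ≤ R d) ∧
      (∀ w, κ * smeas (prodMeas q) (levelSet V (insert i I) (A' ∩ B') (w - v))
        ≤ smeas (prodMeas q) (levelSet V I (A ∩ B) w)) ∧
      (Real.exp (κ * c / 8) * (smeas (prodMeas q) A * smeas (prodMeas q) B)
          ≤ smeas (prodMeas q) A' * smeas (prodMeas q) B' ∨
        (Real.exp (-4 * c) * (smeas (prodMeas q) A * smeas (prodMeas q) B)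
          ≤ smeas (prodMeas q) A' * smeas (prodMeas q) B' ∧
        ∀ w, κ * smeas (prodMeas q) (levelSet V (insert i I) (A' ∩ B') (w - v + u))
          ≤ smeas (prodMeas q) (levelSet V I (A ∩ B) w))) := by
  have hq0 : ∀ i x, 0 ≤ q i x := fun i x => hκ.le.trans (hq i x)
  have hα := smeas_eq_sum_sect i (hq1 i) A
  have hβ := smeas_eq_sum_sect i (hq1 i) B
  set α := smeas (prodMeas q) A with hαdef
  set β := smeas (prodMeas q) B with hβdef
  have hα0 : 0 ≤ α := smeas_nonneg hq0 _
  have hβ0 : 0 ≤ β := smeas_nonneg hq0 _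
  have hαβ : 0 ≤ α * β := mul_nonneg hα0 hβ0
  have hexp : Real.exp (κ * c / 8) ≤ 1 + κ * (c / 4) := by
    have := exp_half_le (t := κ * (c / 4)) (by positivity) (by nlinarith)
    rwa [show κ * (c / 4) / 2 = κ * c / 8 by ring] at this
  by_cases h1 : ∃ z, (1 + κ * (c / 4)) * α < smeas (prodMeas q) (sect i z A)
  · obtain ⟨z, hz⟩ := h1
    obtain ⟨y, hy⟩ := exists_le_of_sum_eq (hq0 i) (hq1 i) hβ.symm
    obtain ⟨x, hzx, hyx⟩ := hr z y
    refine ⟨sect i x A, sect i x B, V i x, hA.sect_univ i x, hB.sect_univ i x, hV i x,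
      fun w => mul_smeas_levelSet_le hκ hq hq1 V hi x (A ∩ B) w, Or.inl ?_⟩
    rw [← hA.sect_congr i hzx, ← hB.sect_congr i hyx]
    calc _ ≤ ((1 + κ * (c / 4)) * α) * β := by
          rw [mul_assoc]; exact mul_le_mul_of_nonneg_right hexp hαβ
      _ ≤ _ := mul_le_mul hz.le hy hβ0 (smeas_nonneg hq0 _)
  by_cases h2 : ∃ z, (1 + κ * (c / 4)) * β < smeas (prodMeas q) (sect i z B)
  · obtain ⟨z, hz⟩ := h2
    obtain ⟨y, hy⟩ := exists_le_of_sum_eq (hq0 i) (hq1 i) hα.symm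
    obtain ⟨x, hyx, hzx⟩ := hr y z
    refine ⟨sect i x A, sect i x B, V i x, hA.sect_univ i x, hB.sect_univ i x, hV i x,
      fun w => mul_smeas_levelSet_le hκ hq hq1 V hi x (A ∩ B) w, Or.inl ?_⟩
    rw [← hA.sect_congr i hyx, ← hB.sect_congr i hzx]
    calc _ ≤ (1 + κ * (c / 4)) * (α * β) := mul_le_mul_of_nonneg_right hexp hαβ
      _ = α * ((1 + κ * (c / 4)) * β) := by ring
      _ ≤ _ := mul_le_mul hy hz.le (by positivity) (smeas_nonneg hq0 _)
  push Not at h1 h2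
  have hlowA := le_of_sum_eq_of_le hκ (hq i) (hq1 i) hα.symm hα0 (by positivity) h1
  have hlowB := le_of_sum_eq_of_le hκ (hq i) (hq1 i) hβ.symm hβ0 (by positivity) h2
  obtain ⟨x, x', y, y', hxy, hxy', hxx, hyy, hu, hv⟩ := hu
  have hsum := smeas_union_add_inter q (sect i y A) (sect i y' A)
  by_cases h3 : (1 + c) * α ≤ smeas (prodMeas q) (sect i y A ∪ sect i y' A)
  · refine ⟨sect i y A ∪ sect i y' A, sect i y B, V i y,
      (hA.sect_univ i y).union (hA.sect_univ i y'), hB.sect_univ i y, hV i y, fun w => ?_,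
      Or.inl ?_⟩
    · have heq : (sect i y A ∪ sect i y' A) ∩ sect i y B
          = sect i y (A ∩ B) ∪ sect i y' (A ∩ B) := by
        rw [show sect i y (A ∩ B) = sect i y A ∩ sect i y B from rfl,
          show sect i y' (A ∩ B) = sect i y' A ∩ sect i y' B from rfl,
          ← hB.sect_congr i hyy, Set.union_inter_distrib_right]
      rw [heq]
      exact mul_smeas_levelSet_union_le hκ hq hq1 V hi hv (A ∩ B) w
    · calc _ ≤ ((1 + c) * α) * ((1 - c / 4) * β) := by
            have : 1 + κ * (c / 4) ≤ (1 + c) * (1 - c / 4) := by nlinarith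
            calc _ ≤ ((1 + c) * (1 - c / 4)) * (α * β) :=
                  mul_le_mul_of_nonneg_right (hexp.trans this) hαβ
              _ = _ := by ring
        _ ≤ _ := mul_le_mul h3 (hlowB y) (mul_nonneg (by linarith) hβ0) (smeas_nonneg hq0 _)
  · push Not at h3
    have hinter : (1 - 3 * c / 2) * α ≤ smeas (prodMeas q) (sect i x A ∩ sect i x' A) := by
      rw [hA.sect_congr i hxy, hA.sect_congr i hxy']
      have := hlowA y
      have := hlowA y'
      nlinarith
    refine ⟨sect i x A ∩ sect i x' A, sect i x B, V i x,
      (hA.sect_univ i x).inter (hA.sect_univ i x'), hB.sect_univ i x, hV i x, fun w => ?_,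
      Or.inr ⟨?_, fun w => ?_⟩⟩
    · refine le_trans (mul_le_mul_of_nonneg_left (smeas_mono hq0 ?_) hκ.le)
        (mul_smeas_levelSet_le hκ hq hq1 V hi x (A ∩ B) w)
      rintro a ⟨⟨⟨ha, -⟩, hb⟩, h⟩
      exact ⟨⟨ha, hb⟩, h⟩
    · have hexp2 : Real.exp (-4 * c) ≤ (1 - 3 * c / 2) * (1 - c / 4) := by
        have h4 := Real.add_one_le_exp (4 * c)
        have h5 : Real.exp (-4 * c) * Real.exp (4 * c) = 1 := by
          rw [← Real.exp_add]; simp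
        have h7 : Real.exp (-4 * c) * (1 + 4 * c) ≤ 1 := by nlinarith
        have h8 : 1 ≤ ((1 - 3 * c / 2) * (1 - c / 4)) * (1 + 4 * c) := by
          nlinarith [mul_nonneg hc.le (by linarith : (0 : ℝ) ≤ 1 / 4 - c), pow_pos hc 3]
        exact le_of_mul_le_mul_right (h7.trans h8) (by linarith)
      calc _ ≤ ((1 - 3 * c / 2) * α) * ((1 - c / 4) * β) := by
            calc _ ≤ ((1 - 3 * c / 2) * (1 - c / 4)) * (α * β) :=
                  mul_le_mul_of_nonneg_right hexp2 hαβ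
              _ = _ := by ring
        _ ≤ _ := mul_le_mul hinter (hlowB x) (mul_nonneg (by linarith) hβ0)
              (smeas_nonneg hq0 _)
    · have heq : w - V i x + u = w - V i x' := by rw [← hu]; abel
      rw [heq]
      refine le_trans (mul_le_mul_of_nonneg_left (smeas_mono hq0 ?_) hκ.le)
        (mul_smeas_levelSet_le hκ hq hq1 V hi x' (A ∩ B) w)
      rintro a ⟨⟨⟨-, ha⟩, hb⟩, h⟩
      rw [hB.sect_congr i hxx] at hb
      exact ⟨⟨ha, hb⟩, h⟩

/-- Iterating `exists_section_step` until `N` coordinates are fixed, or each transfer vector has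
been made available `s` times. -/
theorem exists_run {q : Fin n → K → ℝ} {κ c : ℝ} (hκ : 0 < κ) (hκ1 : κ ≤ 1)
    (hc : 0 < c) (hc1 : c ≤ 1 / 4) (hq : ∀ i x, κ ≤ q i x) (hq1 : ∀ i, ∑ x, q i x = 1)
    {rA rB : Setoid K} (hr : ∀ x y, ∃ z, rA x z ∧ rB y z) {V : Fin n → K → Fin D → ℤ}
    {R : Fin D → ℝ} (hV : ∀ i x d, |(V i x d : ℝ)| ≤ R d) {M : ℕ} {U : Fin M → Fin D → ℤ}
    {P : Fin M → Finset (Fin n)} (hP : ∀ m, ∀ i ∈ P m, HasTransfer rA rB (V i) (U m))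
    {A B : Set (Fin n → K)} (hA : Determined rA univ A) (hB : Determined rB univ B)
    (w : Fin D → ℤ) (s N : ℕ) (hN : ∀ m, N ≤ (P m).card) :
    ∃ (I : Finset (Fin n)) (t : Fin M → ℕ) (A' B' : Set (Fin n → K)) (v : Fin D → ℤ),
      Determined rA univ A' ∧ Determined rB univ B' ∧ I.card ≤ N ∧ (∀ m, t m ≤ s) ∧
      ∑ m, t m ≤ I.card ∧ (∀ d, |(v d : ℝ)| ≤ I.card * R d) ∧
      Real.exp (κ * c / 8 * ((I.card : ℝ) - (∑ m, t m : ℕ)) - 4 * c * (∑ m, t m : ℕ))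
          * (smeas (prodMeas q) A * smeas (prodMeas q) B)
        ≤ smeas (prodMeas q) A' * smeas (prodMeas q) B' ∧
      (∀ a : Fin M → ℕ, (∀ m, a m ≤ t m) →
        κ ^ I.card * smeas (prodMeas q) (levelSet V I (A' ∩ B') (w - v + ∑ m, (a m : ℤ) • U m))
          ≤ smeas (prodMeas q) (levelSet V ∅ (A ∩ B) w)) ∧
      ((∀ m, t m = s) ∨ I.card = N) := by
  induction N with
  | zero =>
    refine ⟨∅, fun _ => 0, A, B, 0, hA, hB, by simp, by simp, by simp, by simp, by simp, ?_,
      by simp⟩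
    intro a ha
    have : a = 0 := funext fun m => Nat.le_zero.1 (ha m)
    simp [this]
  | succ N ih =>
    obtain ⟨I, t, A', B', v, hA', hB', hI, ht, htI, hv, hμ, hF, hend⟩ :=
      ih fun m => (Nat.le_succ N).trans (hN m)
    by_cases hdone : ∀ m, t m = s
    · exact ⟨I, t, A', B', v, hA', hB', hI.trans (Nat.le_succ N), ht, htI, hv, hμ, hF,
        Or.inl hdone⟩
    have hIN : I.card = N := hend.resolve_left hdone
    push Not at hdone
    obtain ⟨m, hm⟩ := hdone
    obtain ⟨i, hiP, hiI⟩ : ∃ i ∈ P m, i ∉ I := by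
      by_contra! hsub
      have := Finset.card_le_card (show P m ⊆ I from hsub)
      have := hN m
      omega
    obtain ⟨A₁, B₁, v₁, hA₁, hB₁, hv₁, hF₁, hstep⟩ :=
      exists_section_step hκ hκ1 hc hc1 hq hq1 hr hV hiI (hP m i hiP) hA' hB'
    have hcard : (insert i I).card = I.card + 1 := Finset.card_insert_of_notMem hiI
    have hv' : ∀ d, |(((v + v₁) d : ℤ) : ℝ)| ≤ ((insert i I).card : ℝ) * R d := by
      intro d
      rw [hcard, Pi.add_apply]
      push_cast
      have := abs_add_le (v d : ℝ) (v₁ d)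
      have := hv d
      have := hv₁ d
      linarith
    have hκI : (0 : ℝ) ≤ κ ^ I.card := by positivity
    have hold : ∀ a : Fin M → ℕ, (∀ m, a m ≤ t m) →
        κ ^ (insert i I).card * smeas (prodMeas q) (levelSet V (insert i I) (A₁ ∩ B₁)
          (w - (v + v₁) + ∑ m, (a m : ℤ) • U m))
          ≤ smeas (prodMeas q) (levelSet V ∅ (A ∩ B) w) := by
      intro a ha
      refine le_trans ?_ (hF a ha)
      rw [hcard, pow_succ, mul_assoc]
      refine mul_le_mul_of_nonneg_left ?_ hκI
      have := hF₁ (w - v + ∑ m, (a m : ℤ) • U m)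
      rwa [show w - v + ∑ m, (a m : ℤ) • U m - v₁
        = w - (v + v₁) + ∑ m, (a m : ℤ) • U m by abel] at this
    rcases hstep with hgain | ⟨hloss, hshift⟩
    · refine ⟨insert i I, t, A₁, B₁, v + v₁, hA₁, hB₁, by omega, ht, by omega, hv', ?_, hold,
        Or.inr (by omega)⟩
      refine le_trans ?_ hgain
      refine le_trans (le_of_eq ?_) (mul_le_mul_of_nonneg_left hμ (Real.exp_pos _).le)
      rw [← mul_assoc (Real.exp _) (Real.exp _), ← Real.exp_add, hcard]
      congr 2
      push_cast
      ring
    · classical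
      have htsum : ∑ m', Function.update t m (t m + 1) m' = ∑ m', t m' + 1 := by
        rw [Finset.sum_update_of_mem (mem_univ m), ← Finset.add_sum_erase univ t (mem_univ m),
          Finset.sdiff_singleton_eq_erase]
        ring
      refine ⟨insert i I, Function.update t m (t m + 1), A₁, B₁, v + v₁, hA₁, hB₁, by omega,
        ?_, by omega, hv', ?_, ?_, Or.inr (by omega)⟩
      · intro m'
        have := ht m'
        by_cases h : m' = m
        · subst h
          rw [Function.update_self]
          omega
        · rwa [Function.update_of_ne h]
      · refine le_trans ?_ hloss
        refine le_trans (le_of_eq ?_) (mul_le_mul_of_nonneg_left hμ (Real.exp_pos _).le)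
        rw [← mul_assoc (Real.exp _) (Real.exp _), ← Real.exp_add, hcard, htsum]
        congr 2
        push_cast
        ring
      · intro a ha
        by_cases ham : a m ≤ t m
        · refine hold a fun m' => ?_
          by_cases h : m' = m
          · exact h ▸ ham
          · simpa [h] using ha m'
        · have ham' : a m = t m + 1 := by
            have := ha m
            rw [Function.update_self] at this
            omega
          have hle : ∀ m', Function.update a m (t m) m' ≤ t m' := by
            intro m'
            by_cases h : m' = m
            · subst h; simp
            · simpa [h] using ha m'
          refine le_trans ?_ (hF _ hle)
          rw [hcard, pow_succ, mul_assoc]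
          refine mul_le_mul_of_nonneg_left ?_ hκI
          have h4 := hshift (w - v + ∑ m', (Function.update a m (t m) m' : ℤ) • U m')
          have hsum : ∑ m', (a m' : ℤ) • U m'
              = ∑ m', (Function.update a m (t m) m' : ℤ) • U m' + U m := by
            rw [← Finset.add_sum_erase univ _ (mem_univ m),
              ← Finset.add_sum_erase univ (fun m' => (Function.update a m (t m) m' : ℤ) • U m')
                (mem_univ m), ham', Function.update_self]
            have : ∑ m' ∈ univ.erase m, (Function.update a m (t m) m' : ℤ) • U m'
                = ∑ m' ∈ univ.erase m, (a m' : ℤ) • U m' :=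
              Finset.sum_congr rfl fun m' hm' => by
                rw [Function.update_of_ne (Finset.ne_of_mem_erase hm')]
            rw [this]
            push_cast
            rw [add_smul, one_smul]
            abel
          rw [hsum]
          rwa [show w - v + ∑ m', (Function.update a m (t m) m' : ℤ) • U m' - v₁ + U m
            = w - (v + v₁) + (∑ m', (Function.update a m (t m) m' : ℤ) • U m' + U m) by
              abel] at h4

/-- If enough coordinates are available, every transfer vector can be made available `s` times
at a small cost in density. -/
theorem exists_complete_run {q : Fin n → K → ℝ} {κ c : ℝ} (hκ : 0 < κ) (hκ1 : κ ≤ 1)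
    (hc : 0 < c) (hc1 : c ≤ 1 / 4) (hq : ∀ i x, κ ≤ q i x) (hq1 : ∀ i, ∑ x, q i x = 1)
    {rA rB : Setoid K} (hr : ∀ x y, ∃ z, rA x z ∧ rB y z) {V : Fin n → K → Fin D → ℤ}
    {R : Fin D → ℝ} (hV : ∀ i x d, |(V i x d : ℝ)| ≤ R d) {M : ℕ} {U : Fin M → Fin D → ℤ}
    {P : Fin M → Finset (Fin n)} (hP : ∀ m, ∀ i ∈ P m, HasTransfer rA rB (V i) (U m))
    {A B : Set (Fin n → K)} (hA : Determined rA univ A) (hB : Determined rB univ B)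
    (w : Fin D → ℤ) {s N : ℕ} (hN : ∀ m, N ≤ (P m).card) {b : ℝ}
    (hb : Real.exp (-b) ≤ smeas (prodMeas q) A * smeas (prodMeas q) B)
    (hNs : 0 < κ * c / 8 * ((N : ℝ) - M * s) - 4 * c * (M * s) - b) :
    ∃ (I : Finset (Fin n)) (A' B' : Set (Fin n → K)) (v : Fin D → ℤ),
      Determined rA univ A' ∧ Determined rB univ B' ∧ I.card ≤ N ∧
      (∀ d, |(v d : ℝ)| ≤ I.card * R d) ∧
      Real.exp (-(4 * c * (M * s) + b)) ≤ smeas (prodMeas q) A' * smeas (prodMeas q) B' ∧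
      ∀ a : Fin M → ℕ, (∀ m, a m ≤ s) →
        κ ^ I.card * smeas (prodMeas q) (levelSet V I (A' ∩ B') (w - v + ∑ m, (a m : ℤ) • U m))
          ≤ smeas (prodMeas q) (levelSet V ∅ (A ∩ B) w) := by
  have hq0 : ∀ i x, 0 ≤ q i x := fun i x => hκ.le.trans (hq i x)
  obtain ⟨I, t, A', B', v, hA', hB', hI, ht, htI, hv, hμ, hF, hend⟩ :=
    exists_run hκ hκ1 hc hc1 hq hq1 hr hV hP hA hB w s N hN
  set τ : ℕ := ∑ m, t m with hτ
  have hτs : (τ : ℝ) ≤ M * s := by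
    have : τ ≤ ∑ _m : Fin M, s := Finset.sum_le_sum fun m _ => ht m
    rw [Finset.sum_const, Finset.card_univ, Fintype.card_fin, smul_eq_mul] at this
    exact_mod_cast this
  have hτI : (τ : ℝ) ≤ I.card := by exact_mod_cast htI
  have hκc : 0 < κ * c / 8 := by positivity
  have hμ' := (mul_le_mul_of_nonneg_left hb (Real.exp_pos _).le).trans hμ
  rw [← Real.exp_add] at hμ'
  have htall : ∀ m, t m = s := by
    refine hend.resolve_right fun hIN => ?_
    have h1 : smeas (prodMeas q) A' * smeas (prodMeas q) B' ≤ 1 :=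
      mul_le_one₀ (smeas_le_one hq0 hq1 _) (smeas_nonneg hq0 _) (smeas_le_one hq0 hq1 _)
    have h2 := Real.exp_le_one_iff.1 (hμ'.trans h1)
    rw [hIN] at h2
    have h3 : κ * c / 8 * ((N : ℝ) - M * s) ≤ κ * c / 8 * ((N : ℝ) - τ) :=
      mul_le_mul_of_nonneg_left (by linarith) hκc.le
    have h4 : 4 * c * (τ : ℝ) ≤ 4 * c * (M * s) :=
      mul_le_mul_of_nonneg_left hτs (by positivity)
    linarith
  refine ⟨I, A', B', v, hA', hB', hI, hv, le_trans (Real.exp_le_exp.2 ?_) hμ',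
    fun a ha => hF a fun m => (htall m).symm ▸ ha m⟩
  have h4 : 4 * c * (τ : ℝ) ≤ 4 * c * (M * s) := mul_le_mul_of_nonneg_left hτs (by positivity)
  have h5 : 0 ≤ κ * c / 8 * ((I.card : ℝ) - τ) := mul_nonneg hκc.le (by linarith)
  linarith

end Transfers

section Tilting

variable {n D : ℕ} {K : Type*} [Fintype K]

theorem sum_add_mul_single_mul [DecidableEq K] (q f : K → ℝ) (t : ℝ) (x x' y y' : K) :
    ∑ z, (q z + t * ((if z = x then 1 else 0) - (if z = x' then 1 else 0)
      - (if z = y then 1 else 0) + (if z = y' then 1 else 0))) * f z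
      = ∑ z, q z * f z + t * (f x - f x' - f y + f y') := by
  simp only [add_mul, sum_add_distrib, mul_assoc, ← mul_sum, sub_mul, sum_sub_distrib, ite_mul,
    one_mul, zero_mul, sum_ite_eq', mem_univ, if_true]

/-- A transfer allows a distribution to be tilted so that its mean moves in the direction of the
transfer vector, without changing either of the two marginals. -/
theorem HasTransfer.exists_tilt {rA rB : Setoid K} {v : K → Fin D → ℤ} {u : Fin D → ℤ}
    (h : HasTransfer rA rB v u) {κ : ℝ} (hκ : 0 < κ) {q : K → ℝ} (hq : ∀ z, κ ≤ q z) {t : ℝ}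
    (ht : |t| ≤ κ / 8) :
    ∃ q' : K → ℝ, (∀ z, κ / 2 ≤ q' z) ∧ (∀ z, q' z ≤ Real.exp (4 * |t| / κ) * q z) ∧
      (∀ f : K → ℝ, (∀ z z', rA z z' → f z = f z') → ∑ z, q' z * f z = ∑ z, q z * f z) ∧
      (∀ f : K → ℝ, (∀ z z', rB z z' → f z = f z') → ∑ z, q' z * f z = ∑ z, q z * f z) ∧
      ∀ d, ∑ z, q' z * v z d = ∑ z, q z * v z d + t * u d := by
  classical
  obtain ⟨x, x', y, y', hxy, hxy', hxx, hyy, hu, hv⟩ := h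
  set e : K → ℝ := fun z => (if z = x then 1 else 0) - (if z = x' then 1 else 0)
      - (if z = y then 1 else 0) + (if z = y' then 1 else 0) with he
  have he4 : ∀ z, |t * e z| ≤ 4 * |t| := by
    intro z
    rw [abs_mul, mul_comm]
    refine mul_le_mul_of_nonneg_right ?_ (abs_nonneg t)
    simp only [he]
    rw [abs_le]
    constructor <;> split_ifs <;> norm_num
  refine ⟨fun z => q z + t * e z, fun z => ?_, fun z => ?_, fun f hf => ?_, fun f hf => ?_,
    fun d => ?_⟩
  · have := neg_le_of_abs_le (he4 z)
    have := hq z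
    linarith
  · have h1 := le_of_abs_le (he4 z)
    have h2 := Real.add_one_le_exp (4 * |t| / κ)
    have h3 : 4 * |t| ≤ 4 * |t| / κ * q z := by
      rw [div_mul_eq_mul_div, le_div_iff₀ hκ]
      exact mul_le_mul_of_nonneg_left (hq z) (by positivity)
    have h4 := mul_le_mul_of_nonneg_right h2 (hκ.le.trans (hq z))
    linarith
  · rw [sum_add_mul_single_mul, hf _ _ hxy, hf _ _ hxy']
    ring
  · rw [sum_add_mul_single_mul, hf _ _ hxx, hf _ _ hyy]
    ring
  · rw [sum_add_mul_single_mul q (fun z => (v z d : ℝ)), hv, ← hu, Pi.sub_apply]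
    push_cast
    ring

/-- Transfers available in many coordinates allow a product measure to be tilted so that the mean
of the array outside `I` moves by a prescribed combination of the transfer vectors. -/
theorem exists_prodMeas_tilt {rA rB : Setoid K} {V : Fin n → K → Fin D → ℤ} {M : ℕ}
    {U : Fin M → Fin D → ℤ} {P : Fin M → Finset (Fin n)}
    (hdisj : ∀ m m', m ≠ m' → Disjoint (P m) (P m'))
    (hP : ∀ m, ∀ i ∈ P m, HasTransfer rA rB (V i) (U m)) {q : Fin n → K → ℝ} {κ : ℝ}
    (hκ : 0 < κ) (hq : ∀ i x, κ ≤ q i x) (I : Finset (Fin n)) {c : Fin M → ℝ}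
    (hc : ∀ m, |c m| ≤ κ / 8 * (P m \ I).card) :
    ∃ q' : Fin n → K → ℝ, (∀ i x, κ / 2 ≤ q' i x) ∧
      (∀ i, ∀ f : K → ℝ, (∀ z z', rA z z' → f z = f z') →
        ∑ z, q' i z * f z = ∑ z, q i z * f z) ∧
      (∀ i, ∀ f : K → ℝ, (∀ z z', rB z z' → f z = f z') →
        ∑ z, q' i z * f z = ∑ z, q i z * f z) ∧
      (∀ X : Set (Fin n → K), smeas (prodMeas q') X
        ≤ Real.exp (4 * (∑ m, |c m|) / κ) * smeas (prodMeas q) X) ∧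
      ∀ d, ∑ i ∈ Iᶜ, ∑ z, q' i z * V i z d
        = ∑ i ∈ Iᶜ, ∑ z, q i z * V i z d + ∑ m, c m * U m d := by
  have hloc : ∀ i, ∃ q' : K → ℝ, (∀ z, κ / 2 ≤ q' z) ∧
      (∀ z, q' z ≤ Real.exp (∑ m, if i ∈ P m \ I then 4 * (|c m| / (P m \ I).card) / κ else 0)
        * q i z) ∧
      (∀ f : K → ℝ, (∀ z z', rA z z' → f z = f z') → ∑ z, q' z * f z = ∑ z, q i z * f z) ∧
      (∀ f : K → ℝ, (∀ z z', rB z z' → f z = f z') → ∑ z, q' z * f z = ∑ z, q i z * f z) ∧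
      ∀ d, ∑ z, q' z * V i z d = ∑ z, q i z * V i z d
        + ∑ m, if i ∈ P m \ I then c m / (P m \ I).card * U m d else 0 := by
    intro i
    by_cases h : ∃ m, i ∈ P m \ I
    · obtain ⟨m, hm⟩ := h
      have hne : ∀ m', m' ≠ m → i ∉ P m' \ I := fun m' hm' hi =>
        Finset.disjoint_left.1 (hdisj m' m hm') (mem_sdiff.1 hi).1 (mem_sdiff.1 hm).1
      have hpos : (0 : ℝ) < (P m \ I).card := by exact_mod_cast Finset.card_pos.2 ⟨i, hm⟩
      have ht : |c m / (P m \ I).card| = |c m| / (P m \ I).card := by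
        rw [abs_div, abs_of_pos hpos]
      obtain ⟨q', h1, h2, h3, h4, h5⟩ := (hP m i (mem_sdiff.1 hm).1).exists_tilt hκ (hq i)
        (t := c m / (P m \ I).card) (by rw [ht, div_le_iff₀ hpos]; exact hc m)
      refine ⟨q', h1, fun z => ?_, h3, h4, fun d => ?_⟩
      · rw [Finset.sum_eq_single m (fun m' _ hm' => if_neg (hne m' hm')) (by simp), if_pos hm,
          ← ht]
        exact h2 z
      · rw [Finset.sum_eq_single m (fun m' _ hm' => if_neg (hne m' hm')) (by simp), if_pos hm]
        exact h5 d
    · push Not at h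
      refine ⟨q i, fun z => ?_, fun z => ?_, fun f _ => rfl, fun f _ => rfl, fun d => ?_⟩
      · have := hq i z
        linarith
      · simp [h]
      · simp [h]
  have hcancel : ∀ m, ∀ x y : ℝ, (|c m| = 0 → y = 0) → x = y / (P m \ I).card →
      (P m \ I).card • x = y := by
    intro m x y hy hx
    by_cases h0 : (P m \ I).card = 0
    · have := hc m
      rw [h0, Nat.cast_zero, mul_zero] at this
      rw [h0, zero_smul, hy (le_antisymm this (abs_nonneg _))]
    · rw [hx, nsmul_eq_mul, mul_div_cancel₀]
      exact_mod_cast h0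
  choose q' h1 h2 h3 h4 h5 using hloc
  refine ⟨q', h1, h3, h4, fun X => ?_, fun d => ?_⟩
  · have := smeas_le_mul_smeas (fun i x => (half_pos hκ).le.trans (h1 i x)) _ h2 X
    convert this using 3
    rw [sum_comm, mul_sum, sum_div]
    refine sum_congr rfl fun m _ => ?_
    rw [← sum_filter, sum_const, filter_mem_eq_inter, univ_inter]
    exact (hcancel m _ _ (fun h => by rw [h]; simp) (by ring)).symm
  · rw [sum_congr rfl fun i _ => h5 i d, sum_add_distrib, add_right_inj, sum_comm]
    refine sum_congr rfl fun m _ => ?_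
    rw [← sum_filter, sum_const, filter_mem_eq_inter, inter_eq_right.2]
    · exact hcancel m _ _ (fun h => by rw [abs_eq_zero.1 h]; simp) (by ring)
    · intro i hi
      exact mem_compl.2 (mem_sdiff.1 hi).2

end Tilting

section Concentration

variable {n : ℕ} {K : Type*} [Fintype K]

theorem sum_mul_exp_le {p : K → ℝ} (hp : ∀ x, 0 ≤ p x) (hp1 : ∑ x, p x = 1) {f : K → ℝ}
    (hf : ∀ x, |f x| ≤ 2) (hf0 : ∑ x, p x * f x = 0) {t : ℝ} (ht : |t| ≤ 1 / 2) :
    ∑ x, p x * Real.exp (t * f x) ≤ Real.exp (4 * t ^ 2) := by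
  have h1 : ∀ x, p x * Real.exp (t * f x) ≤ p x * (1 + 4 * t ^ 2) + t * (p x * f x) := by
    intro x
    have h2 : |t * f x| ≤ 1 := by
      rw [abs_mul]
      nlinarith [hf x, abs_nonneg t, abs_nonneg (f x)]
    have h3 := le_of_abs_le (Real.abs_exp_sub_one_sub_id_le h2)
    have h4 : (t * f x) ^ 2 ≤ 4 * t ^ 2 := by
      have : f x ^ 2 ≤ 2 ^ 2 := sq_le_sq' (neg_le_of_abs_le (hf x)) (le_of_abs_le (hf x))
      rw [mul_pow]
      nlinarith [sq_nonneg t]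
    have h5 : Real.exp (t * f x) ≤ 1 + 4 * t ^ 2 + t * f x := by linarith
    have := mul_le_mul_of_nonneg_left h5 (hp x)
    linarith
  calc _ ≤ ∑ x, (p x * (1 + 4 * t ^ 2) + t * (p x * f x)) := sum_le_sum fun x _ => h1 x
    _ = 4 * t ^ 2 + 1 := by rw [sum_add_distrib, ← sum_mul, ← mul_sum, hp1, hf0]; ring
    _ ≤ _ := Real.add_one_le_exp _

theorem smeas_le_exp_mul_sum {μ : (Fin n → K) → ℝ} (hμ : ∀ a, 0 ≤ μ a) (g : (Fin n → K) → ℝ)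
    (b : ℝ) : smeas μ {a | b ≤ g a} ≤ Real.exp (-b) * ∑ a, μ a * Real.exp (g a) := by
  rw [smeas, mul_sum]
  refine sum_le_sum fun a _ => ?_
  by_cases h : b ≤ g a
  · rw [Set.indicator_of_mem (by exact h)]
    have : 1 ≤ Real.exp (-b) * Real.exp (g a) := by
      rw [← Real.exp_add]
      exact Real.one_le_exp (by linarith)
    nlinarith [hμ a]
  · rw [Set.indicator_of_notMem (by exact h)]
    exact mul_nonneg (Real.exp_pos _).le (mul_nonneg (hμ a) (Real.exp_pos _).le)

/-- A Chernoff bound for the upper tail of a sum of independent bounded centred variables. -/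
theorem smeas_upper_tail_le {q : Fin n → K → ℝ} (hq : ∀ i x, 0 ≤ q i x)
    (hq1 : ∀ i, ∑ x, q i x = 1) {f : Fin n → K → ℝ} (hf : ∀ i x, |f i x| ≤ 2)
    (hf0 : ∀ i, ∑ x, q i x * f i x = 0) {τ : ℝ} (hτ : 0 < τ) (hτ1 : τ ≤ 1) :
    smeas (prodMeas q) {a | τ * n ≤ ∑ i, f i (a i)} ≤ Real.exp (-(τ ^ 2 * n / 16)) := by
  have h1 := smeas_le_exp_mul_sum (prodMeas_nonneg hq) (fun a => ∑ i, τ / 8 * f i (a i))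
    (τ / 8 * (τ * n))
  have hset : {a : Fin n → K | τ / 8 * (τ * n) ≤ ∑ i, τ / 8 * f i (a i)}
      = {a | τ * n ≤ ∑ i, f i (a i)} := by
    ext a
    simp only [Set.mem_ofPred_eq, ← mul_sum]
    exact mul_le_mul_iff_right₀ (by positivity)
  rw [hset] at h1
  refine h1.trans ?_
  have h2 : ∑ a, prodMeas q a * Real.exp (∑ i, τ / 8 * f i (a i))
      ≤ Real.exp (4 * (τ / 8) ^ 2) ^ n := by
    simp only [Real.exp_sum]
    rw [sum_prodMeas_mul_prod q fun i x => Real.exp (τ / 8 * f i x)]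
    calc _ ≤ ∏ _i : Fin n, Real.exp (4 * (τ / 8) ^ 2) :=
          prod_le_prod (fun i _ => sum_nonneg fun x _ => mul_nonneg (hq i x) (Real.exp_pos _).le)
            fun i _ => sum_mul_exp_le (hq i) (hq1 i) (hf i) (hf0 i)
              (by rw [abs_of_pos (by positivity)]; linarith)
      _ = _ := by simp
  refine (mul_le_mul_of_nonneg_left h2 (Real.exp_pos _).le).trans (le_of_eq ?_)
  rw [← Real.exp_nat_mul, ← Real.exp_add]
  congr 1
  ring

theorem smeas_tail_le {q : Fin n → K → ℝ} (hq : ∀ i x, 0 ≤ q i x)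
    (hq1 : ∀ i, ∑ x, q i x = 1) {f : Fin n → K → ℝ} (hf : ∀ i x, |f i x| ≤ 1)
    {τ : ℝ} (hτ : 0 < τ) (hτ1 : τ ≤ 1) :
    smeas (prodMeas q) {a | τ * n ≤ |∑ i, (f i (a i) - ∑ x, q i x * f i x)|}
      ≤ 2 * Real.exp (-(τ ^ 2 * n / 16)) := by
  have hmean : ∀ i, |∑ x, q i x * f i x| ≤ 1 := fun i => by
    calc _ ≤ ∑ x, |q i x * f i x| := abs_sum_le_sum_abs _ _
      _ ≤ ∑ x, q i x := sum_le_sum fun x _ => by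
          rw [abs_mul, abs_of_nonneg (hq i x)]
          exact mul_le_of_le_one_right (hq i x) (hf i x)
      _ = 1 := hq1 i
  have hg : ∀ i x, |f i x - ∑ y, q i y * f i y| ≤ 2 := fun i x => by
    have := abs_sub (f i x) (∑ y, q i y * f i y)
    linarith [hf i x, hmean i]
  have hg0 : ∀ i, ∑ x, q i x * (f i x - ∑ y, q i y * f i y) = 0 := fun i => by
    simp only [mul_sub, sum_sub_distrib]
    rw [← sum_mul, hq1]
    ring
  have h1 := smeas_upper_tail_le hq hq1 hg hg0 hτ hτ1
  have h2 := smeas_upper_tail_le hq hq1 (f := fun i x => -(f i x - ∑ y, q i y * f i y))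
    (fun i x => by rw [abs_neg]; exact hg i x)
    (fun i => by simp only [mul_neg, sum_neg_distrib, hg0 i, neg_zero]) hτ hτ1
  refine le_trans (smeas_mono hq ?_) ((smeas_union_le hq _ _).trans
    (by rw [two_mul]; exact add_le_add h1 h2))
  intro a ha
  rcases le_abs.1 (show τ * n ≤ |∑ i, (f i (a i) - ∑ x, q i x * f i x)| from ha) with h | h
  · exact Or.inl h
  · refine Or.inr ?_
    show τ * n ≤ ∑ i, -(f i (a i) - ∑ x, q i x * f i x)
    rwa [sum_neg_distrib]

theorem sum_prodMeas_mul_apply {q : Fin n → K → ℝ} (hq1 : ∀ i, ∑ x, q i x = 1) (i : Fin n)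
    (f : K → ℝ) : ∑ a, prodMeas q a * f (a i) = ∑ x, q i x * f x := by
  rw [sum_prodMeas_update i (hq1 i)]
  refine sum_congr rfl fun x _ => ?_
  simp only [Function.update_self]
  rw [← sum_mul, sum_prodMeas hq1, one_mul]

theorem arrExp_prodMeas {D : ℕ} {q : Fin n → K → ℝ} (hq1 : ∀ i, ∑ x, q i x = 1)
    (V : Fin n → K → Fin D → ℤ) (d : Fin D) :
    arrExp V (prodMeas q) d = ∑ i, ∑ x, q i x * V i x d := by
  simp only [arrExp, arrEval, Int.cast_sum, mul_sum]
  rw [sum_comm]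
  exact sum_congr rfl fun i _ => sum_prodMeas_mul_apply hq1 i fun x => (V i x d : ℝ)

end Concentration

section Counting

variable {n D M : ℕ} {K : Type*} [Fintype K]

theorem smeas_le_smeas_concentrated_add {q : Fin n → K → ℝ} (hq : ∀ i x, 0 ≤ q i x)
    (hq1 : ∀ i, ∑ x, q i x = 1) {V : Fin n → K → Fin D → ℤ} {R : Fin D → ℝ}
    (hR : ∀ d, 0 < R d) (hV : ∀ i x d, |(V i x d : ℝ)| ≤ R d) (I : Finset (Fin n)) {τ : ℝ}
    (hτ : 0 < τ) (hτ1 : τ ≤ 1) (X : Set (Fin n → K)) :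
    smeas (prodMeas q) X ≤ smeas (prodMeas q) {a | a ∈ X ∧ ∀ d,
        |∑ i ∈ Iᶜ, (V i (a i) d : ℝ) - ∑ i ∈ Iᶜ, ∑ x, q i x * V i x d| ≤ τ * n * R d}
      + D * (2 * Real.exp (-(τ ^ 2 * n / 16))) := by
  classical
  set f : Fin D → Fin n → K → ℝ := fun d i x => if i ∈ Iᶜ then V i x d / R d else 0 with hf
  have hfle : ∀ d i x, |f d i x| ≤ 1 := by
    intro d i x
    simp only [hf]
    split_ifs
    · rw [abs_div, abs_of_pos (hR d), div_le_one (hR d)]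
      exact hV i x d
    · simp
  have hfsum : ∀ d (a : Fin n → K), ∑ i, (f d i (a i) - ∑ x, q i x * f d i x)
      = (∑ i ∈ Iᶜ, (V i (a i) d : ℝ) - ∑ i ∈ Iᶜ, ∑ x, q i x * V i x d) / R d := by
    intro d a
    rw [← sum_sub_distrib, sum_div, ← sum_subset (subset_univ Iᶜ)]
    · refine sum_congr rfl fun i hi => ?_
      simp only [hf, if_pos hi, sub_div, sum_div, mul_div_assoc]
    · intro i _ hi
      simp only [hf, if_neg hi, mul_zero, sum_const_zero, sub_zero]
  have hsub : X ⊆ {a | a ∈ X ∧ ∀ d,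
        |∑ i ∈ Iᶜ, (V i (a i) d : ℝ) - ∑ i ∈ Iᶜ, ∑ x, q i x * V i x d| ≤ τ * n * R d} ∪
      ⋃ d ∈ (univ : Finset (Fin D)),
        {a | τ * n ≤ |∑ i, (f d i (a i) - ∑ x, q i x * f d i x)|} := by
    intro a ha
    by_cases h : ∀ d,
        |∑ i ∈ Iᶜ, (V i (a i) d : ℝ) - ∑ i ∈ Iᶜ, ∑ x, q i x * V i x d| ≤ τ * n * R d
    · exact Or.inl ⟨ha, h⟩
    · push Not at h
      obtain ⟨d, hd⟩ := h
      refine Or.inr (Set.mem_iUnion₂.2 ⟨d, mem_univ d, ?_⟩)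
      show τ * n ≤ |∑ i, (f d i (a i) - ∑ x, q i x * f d i x)|
      rw [hfsum, abs_div, abs_of_pos (hR d), le_div_iff₀ (hR d)]
      exact hd.le
  refine (smeas_mono hq hsub).trans ((smeas_union_le hq _ _).trans
    (add_le_add le_rfl ((smeas_iUnion_le hq _ _).trans ?_)))
  refine (sum_le_sum fun d _ => smeas_tail_le hq hq1 (hfle d) hτ hτ1).trans (le_of_eq ?_)
  simp

theorem smeas_le_of_forall_exists_levelSet {q : Fin n → K → ℝ} (hq : ∀ i x, 0 ≤ q i x)
    {V : Fin n → K → Fin D → ℤ} {I : Finset (Fin n)} {G A : Set (Fin n → K)} {w : Fin D → ℤ}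
    {U : Fin M → Fin D → ℤ} {s : ℕ} {F : ℝ}
    (hG : ∀ a ∈ G, ∃ t : Fin M → ℕ, (∀ m, t m ≤ s) ∧
      a ∈ levelSet V I A (w + ∑ m, (t m : ℤ) • U m))
    (hF : ∀ t : Fin M → ℕ, (∀ m, t m ≤ s) →
      smeas (prodMeas q) (levelSet V I A (w + ∑ m, (t m : ℤ) • U m)) ≤ F) :
    smeas (prodMeas q) G ≤ ((s : ℝ) + 1) ^ M * F := by
  classical
  set T : Finset (Fin M → ℕ) := Fintype.piFinset fun _ => range (s + 1) with hT
  have hmem : ∀ t, t ∈ T ↔ ∀ m, t m ≤ s := fun t => by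
    simp [hT]
  have hsub : G ⊆ ⋃ t ∈ T, levelSet V I A (w + ∑ m, (t m : ℤ) • U m) := fun a ha => by
    obtain ⟨t, ht, hat⟩ := hG a ha
    exact Set.mem_iUnion₂.2 ⟨t, (hmem t).2 ht, hat⟩
  refine (smeas_mono hq hsub).trans ((smeas_iUnion_le hq _ _).trans ?_)
  refine (sum_le_card_nsmul T _ F fun t ht => hF t ((hmem t).1 ht)).trans (le_of_eq ?_)
  rw [nsmul_eq_mul, hT, Fintype.card_piFinset_const, card_range]
  push_cast
  rfl

theorem abs_sum_mul_le {p f : K → ℝ} (hp : ∀ x, 0 ≤ p x) (hp1 : ∑ x, p x = 1) {r : ℝ}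
    (hf : ∀ x, |f x| ≤ r) : |∑ x, p x * f x| ≤ r := by
  calc _ ≤ ∑ x, |p x * f x| := abs_sum_le_sum_abs _ _
    _ ≤ ∑ x, p x * r := sum_le_sum fun x _ => by
        rw [abs_mul, abs_of_nonneg (hp x)]
        exact mul_le_mul_of_nonneg_left (hf x) (hp x)
    _ = r := by rw [← sum_mul, hp1, one_mul]

/-- A quantitative two-part forbidden intersection bound, with all error terms explicit. -/
theorem smeas_levelSet_lower_bound {q : Fin n → K → ℝ} {κ c : ℝ} (hκ : 0 < κ) (hκ1 : κ ≤ 1)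
    (hc : 0 < c) (hc1 : c ≤ 1 / 4) (hq : ∀ i x, κ ≤ q i x) (hq1 : ∀ i, ∑ x, q i x = 1)
    {rA rB : Setoid K} (hr : ∀ x y, ∃ z, rA x z ∧ rB y z) {V : Fin n → K → Fin D → ℤ}
    {R : Fin D → ℝ} (hR : ∀ d, 1 ≤ R d) (hV : ∀ i x d, |(V i x d : ℝ)| ≤ R d)
    {U : Fin M → Fin D → ℤ} (hU : ∀ m d, |(U m d : ℝ)| ≤ R d) {k g : ℝ}
    (hgen : ∀ (r : ℝ) (u : Fin D → ℤ), 0 ≤ r → (∀ d, |(u d : ℝ)| ≤ r * R d) →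
      ∃ t : Fin M → ℤ, (∀ m, |(t m : ℝ)| ≤ k * r + g) ∧ u = ∑ m, t m • U m)
    {P : Fin M → Finset (Fin n)} (hdisj : ∀ m m', m ≠ m' → Disjoint (P m) (P m'))
    (hP : ∀ m, ∀ i ∈ P m, HasTransfer rA rB (V i) (U m))
    {A B : Set (Fin n → K)} (hA : Determined rA univ A) (hB : Determined rB univ B)
    {w : Fin D → ℤ} {z : ℝ} (hw : ∀ d, |(w d : ℝ) - ∑ i, ∑ x, q i x * V i x d| ≤ z * R d)
    (hz : 0 ≤ z) {s N L : ℕ} {b r τ Y e : ℝ}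
    (hb : Real.exp (-b) ≤ smeas (prodMeas q) A * smeas (prodMeas q) B)
    (hNs : 0 < κ * c / 8 * ((N : ℝ) - M * (2 * s)) - 4 * c * (M * (2 * s)) - b)
    (hrhc : ∀ q' : Fin n → K → ℝ, (∀ i x, κ / 2 ≤ q' i x) → (∀ i, ∑ x, q' i x = 1) →
      ∀ A' B', Determined rA univ A' → Determined rB univ B' →
        Real.exp (-r) * (smeas (prodMeas q') A' * smeas (prodMeas q') B') ^ L
          ≤ smeas (prodMeas q') (A' ∩ B'))
    (hY : k * (z + 2 * N + M * s + 1) + g ≤ Y) (hYP : ∀ m, Y ≤ κ / 8 * ((P m).card - N))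
    (hN : ∀ m, N ≤ (P m).card)
    (hτ : 0 < τ) (hτ1 : τ ≤ 1) (hs : k * (τ * n + 1) + g ≤ s)
    (he : r + L * (4 * c * (M * (2 * s)) + b) ≤ e)
    (hDe : 2 * (D * (2 * Real.exp (-(τ ^ 2 * n / 16)))) ≤ Real.exp (-e)) :
    κ ^ N * Real.exp (-e) ≤ 2 * (2 * s + 1) ^ M * Real.exp (4 * (M * Y) / κ)
      * smeas (prodMeas q) (levelSet V ∅ (A ∩ B) w) := by
  have hq0 : ∀ i x, 0 ≤ q i x := fun i x => hκ.le.trans (hq i x)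
  have hR0 : ∀ d, 0 < R d := fun d => one_pos.trans_le (hR d)
  obtain ⟨I, A', B', v, hA', hB', hI, hv, hμ, hF⟩ :=
    exists_complete_run hκ hκ1 hc hc1 hq hq1 hr hV hP hA hB w (s := 2 * s) hN hb
      (by push_cast; exact hNs)
  push_cast at hμ
  have hIR : (I.card : ℝ) ≤ N := by exact_mod_cast hI
  set E : Fin D → ℝ := fun d => ∑ i ∈ Iᶜ, ∑ x, q i x * V i x d with hE
  set y : Fin D → ℝ := fun d => (w d : ℝ) - v d + s * ∑ m, (U m d : ℝ) - E d with hy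
  have hyle : ∀ d, |y d| ≤ (z + 2 * N + M * s) * R d := by
    intro d
    have h1 : ∑ i, ∑ x, q i x * (V i x d : ℝ) = ∑ i ∈ I, ∑ x, q i x * (V i x d : ℝ) + E d :=
      (sum_add_sum_compl I _).symm
    have h2 : |∑ i ∈ I, ∑ x, q i x * (V i x d : ℝ)| ≤ I.card * R d := by
      refine (abs_sum_le_sum_abs _ _).trans ((sum_le_card_nsmul I _ (R d) fun i _ =>
        abs_sum_mul_le (hq0 i) (hq1 i) fun x => hV i x d).trans (le_of_eq ?_))
      rw [nsmul_eq_mul]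
    have h3 : |∑ m, (U m d : ℝ)| ≤ M * R d := by
      refine (abs_sum_le_sum_abs _ _).trans ((sum_le_card_nsmul univ _ (R d) fun m _ =>
        hU m d).trans (le_of_eq ?_))
      simp
    have h4 : |(s : ℝ) * ∑ m, (U m d : ℝ)| ≤ s * (M * R d) := by
      rw [abs_mul, Nat.abs_cast]
      exact mul_le_mul_of_nonneg_left h3 (Nat.cast_nonneg s)
    have h5 : y d = ((w d : ℝ) - ∑ i, ∑ x, q i x * V i x d)
        + ∑ i ∈ I, ∑ x, q i x * (V i x d : ℝ) - v d + s * ∑ m, (U m d : ℝ) := by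
      rw [h1]; simp only [hy]; ring
    have h6 := mul_le_mul_of_nonneg_right hIR (hR0 d).le
    have h7 := abs_le.1 (hw d)
    have h8 := abs_le.1 (hv d)
    have h9 := abs_le.1 h2
    have h10 := abs_le.1 h4
    rw [h5, abs_le]
    constructor <;> linarith
  obtain ⟨t, ht, htU⟩ := hgen (z + 2 * N + M * s + 1) (fun d => round (y d)) (by positivity)
    fun d => by
      have h1 := abs_le.1 (abs_sub_round (y d))
      have h2 := abs_le.1 (hyle d)
      have h3 := hR d
      rw [abs_le]
      constructor <;> linarith
  have htY : ∀ m, |(t m : ℝ)| ≤ Y := fun m => (ht m).trans hY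
  obtain ⟨q', hq', hqA, hqB, hle, hmean⟩ := exists_prodMeas_tilt hdisj hP hκ hq I
    (c := fun m => (t m : ℝ)) fun m => by
      refine (htY m).trans ((hYP m).trans (mul_le_mul_of_nonneg_left ?_ (by positivity)))
      have h1 : (P m).card ≤ (P m \ I).card + I.card := by
        rw [add_comm]
        exact card_le_card_sdiff_add_card.trans (le_of_eq (add_comm _ _))
      have h2 : ((P m).card : ℝ) ≤ (P m \ I).card + I.card := by exact_mod_cast h1
      linarith
  have hq'0 : ∀ i x, 0 ≤ q' i x := fun i x => (half_pos hκ).le.trans (hq' i x)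
  have hq'1 : ∀ i, ∑ x, q' i x = 1 := fun i => by
    have := hqA i (fun _ => 1) fun _ _ _ => rfl
    simpa [hq1] using this
  have hcorr := hrhc q' hq' hq'1 A' B' hA' hB'
  rw [smeas_eq_of_determined hq1 hq'1 hqA univ A' hA',
    smeas_eq_of_determined hq1 hq'1 hqB univ B' hB'] at hcorr
  have hdense : Real.exp (-e) ≤ smeas (prodMeas q') (A' ∩ B') := by
    refine le_trans ?_ ((mul_le_mul_of_nonneg_left (pow_le_pow_left₀ (Real.exp_pos _).le hμ L)
      (Real.exp_pos _).le).trans hcorr)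
    rw [← Real.exp_nat_mul, ← Real.exp_add, Real.exp_le_exp]
    linarith
  have hconc := smeas_le_smeas_concentrated_add hq'0 hq'1 hR0 hV I hτ hτ1 (A' ∩ B')
  set G : Set (Fin n → K) := {a | a ∈ A' ∩ B' ∧ ∀ d,
    |∑ i ∈ Iᶜ, (V i (a i) d : ℝ) - ∑ i ∈ Iᶜ, ∑ x, q' i x * V i x d| ≤ τ * n * R d} with hG
  have hround : ∀ d, ((round (y d) : ℤ) : ℝ) = ∑ m, (t m : ℝ) * U m d := fun d => by
    have := congrFun htU d
    simp only [Finset.sum_apply, Pi.smul_apply, smul_eq_mul] at this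
    rw [this]
    push_cast
    rfl
  have hGlevel : ∀ a ∈ G, ∃ j : Fin M → ℕ, (∀ m, j m ≤ 2 * s) ∧
      a ∈ levelSet V I (A' ∩ B') (w - v + ∑ m, (j m : ℤ) • U m) := by
    rintro a ⟨ha, hclose⟩
    obtain ⟨j, hj, hjU⟩ := hgen (τ * n + 1)
      (∑ i ∈ Iᶜ, V i (a i) - (w - v) - (s : ℤ) • ∑ m, U m) (by positivity) fun d => by
        have h1 := abs_le.1 (abs_sub_round (y d))
        have h2 := abs_le.1 (hclose d)
        rw [hmean d, ← hround d] at h2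
        have h3 := hR d
        simp only [Pi.sub_apply, Finset.sum_apply, Pi.smul_apply, smul_eq_mul]
        push_cast
        simp only [hy, hE] at h1 h2 ⊢
        rw [abs_le]
        constructor <;> linarith
    have hjs : ∀ m, -(s : ℤ) ≤ j m ∧ j m ≤ s := fun m => by
      have := abs_le.1 ((hj m).trans hs)
      exact ⟨by exact_mod_cast this.1, by exact_mod_cast this.2⟩
    refine ⟨fun m => (j m + s).toNat, fun m => ?_, ha, ?_⟩
    · have := hjs m
      show (j m + s).toNat ≤ 2 * s
      omega
    · have h1 : ∀ m, (((j m + s).toNat : ℕ) : ℤ) = j m + s := fun m =>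
        Int.toNat_of_nonneg (by have := hjs m; omega)
      simp only [h1, add_smul, sum_add_distrib, ← hjU, ← smul_sum]
      abel
  set F := smeas (prodMeas q) (levelSet V ∅ (A ∩ B) w) with hFdef
  have hκN : 0 < κ ^ N := pow_pos hκ N
  have hlevel : ∀ j : Fin M → ℕ, (∀ m, j m ≤ 2 * s) →
      smeas (prodMeas q') (levelSet V I (A' ∩ B') (w - v + ∑ m, (j m : ℤ) • U m))
        ≤ Real.exp (4 * (M * Y) / κ) * (F / κ ^ N) := by
    intro j hj
    refine (hle _).trans (mul_le_mul (Real.exp_le_exp.2 ?_) ?_ (smeas_nonneg hq0 _)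
      (Real.exp_pos _).le)
    · refine div_le_div_of_nonneg_right (mul_le_mul_of_nonneg_left ?_ (by norm_num)) hκ.le
      exact (sum_le_card_nsmul univ _ Y fun m _ => htY m).trans (le_of_eq (by simp))
    · rw [le_div_iff₀ hκN, mul_comm]
      refine le_trans (mul_le_mul_of_nonneg_right ?_ (smeas_nonneg hq0 _)) (hF j hj)
      exact pow_le_pow_of_le_one hκ.le hκ1 hI
  have hcount := smeas_le_of_forall_exists_levelSet hq'0 hGlevel hlevel
  push_cast at hcount
  have h1 : Real.exp (-e) ≤ 2 * smeas (prodMeas q') G := by linarith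
  calc κ ^ N * Real.exp (-e)
      ≤ κ ^ N * (2 * ((2 * s + 1) ^ M * (Real.exp (4 * (M * Y) / κ) * (F / κ ^ N)))) :=
        mul_le_mul_of_nonneg_left (by linarith) hκN.le
    _ = _ := by field_simp

end Counting

section Parameters

theorem exists_two_mul_pow_le_exp (M : ℕ) {ρ : ℝ} (hρ : 0 < ρ) :
    ∃ n₀ : ℕ, ∀ n : ℕ, n₀ ≤ n → 2 * (2 * (n : ℝ) + 1) ^ M ≤ Real.exp (ρ * n) := by
  have h := ((isLittleO_pow_exp_pos_mul_atTop M hρ).comp_tendsto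
    tendsto_natCast_atTop_atTop).def (c := (2 * 3 ^ M)⁻¹) (by positivity)
  obtain ⟨n₀, hn₀⟩ := Filter.eventually_atTop.1 h
  refine ⟨max n₀ 1, fun n hn => ?_⟩
  have h1 : (1 : ℝ) ≤ n := by exact_mod_cast (le_max_right n₀ 1).trans hn
  have h2 := hn₀ n ((le_max_left n₀ 1).trans hn)
  simp only [Function.comp, Real.norm_eq_abs, Real.abs_exp] at h2
  rw [abs_of_nonneg (by positivity), inv_mul_eq_div, le_div_iff₀ (by positivity)] at h2
  calc 2 * (2 * (n : ℝ) + 1) ^ M ≤ 2 * (3 * n) ^ M := by gcongr; linarith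
    _ = (n : ℝ) ^ M * (2 * 3 ^ M) := by rw [mul_pow]; ring
    _ ≤ _ := h2

theorem exp_neg_inv_le {κ : ℝ} (hκ : 0 < κ) : Real.exp (-(1 / κ)) ≤ κ := by
  rw [Real.exp_neg, inv_le_comm₀ (Real.exp_pos _) hκ, ← one_div]
  linarith [Real.add_one_le_exp (1 / κ)]

theorem exp_neg_le_of_mul_le_mul {x a b p y F : ℝ} (hy : 0 ≤ y) (hF : 0 ≤ F)
    (ha : Real.exp (-x) ≤ a) (hb : Real.exp (-x) ≤ b) (hp : p ≤ Real.exp x)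
    (hyx : y ≤ Real.exp x) (h : a * b ≤ p * y * F) : Real.exp (-(4 * x)) ≤ F := by
  have h1 : Real.exp (-x) * Real.exp (-x) ≤ Real.exp x * Real.exp x * F :=
    (mul_le_mul ha hb (Real.exp_pos _).le ((Real.exp_pos _).le.trans ha)).trans (h.trans
      (mul_le_mul_of_nonneg_right (mul_le_mul hp hyx hy (Real.exp_pos _).le) hF))
  rw [← Real.exp_add, ← Real.exp_add] at h1
  have h2 : Real.exp (-(4 * x)) * Real.exp (x + x) = Real.exp (-x + -x) := by
    rw [← Real.exp_add]
    congr 1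
    ring
  rw [← h2, mul_comm] at h1
  exact le_of_mul_le_mul_left h1 (Real.exp_pos _)

set_option maxHeartbeats 1000000 in
/-- If two determined sets have subexponentially small loss of density, then so does every level
set of their intersection with target close to the mean of the array. -/
theorem exists_forall_lt_smeas_levelSet (D M k : ℕ) {ε κ γ : ℝ} (hε : 0 < ε) (hε1 : ε < 1)
    (hκ : 0 < κ) (hκ1 : κ < 1) (hγ : 0 < γ) (hγ1 : γ < 1) :
    ∃ θ > (0 : ℝ), ∃ β > (0 : ℝ), ∃ n₀ : ℕ, ∀ ζ ∈ Set.Ioo 0 θ, ∀ n : ℕ, n₀ ≤ n →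
      ∀ {K : Type} [Fintype K] {q : Fin n → K → ℝ}, (∀ i x, κ ≤ q i x) →
      (∀ i, ∑ x, q i x = 1) → ∀ {rA rB : Setoid K}, (∀ x y, ∃ z, rA x z ∧ rB y z) →
      ∀ {V : Fin n → K → Fin D → ℤ} {R : Fin D → ℝ}, (∀ d, 1 ≤ R d) →
      (∀ i x d, |(V i x d : ℝ)| ≤ R d) →
      ∀ {U : Fin M → Fin D → ℤ}, (∀ m d, |(U m d : ℝ)| ≤ R d) →
      (∀ (r : ℝ) (u : Fin D → ℤ), 0 ≤ r → (∀ d, |(u d : ℝ)| ≤ r * R d) →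
        ∃ t : Fin M → ℤ, (∀ m, |(t m : ℝ)| ≤ k * r + k * ζ * n) ∧ u = ∑ m, t m • U m) →
      ∀ {P : Fin M → Finset (Fin n)}, (∀ m m', m ≠ m' → Disjoint (P m) (P m')) →
      (∀ m, γ * n ≤ (P m).card) → (∀ m, ∀ i ∈ P m, HasTransfer rA rB (V i) (U m)) →
      ∀ {A B : Set (Fin n → K)}, Determined rA univ A → Determined rB univ B →
      ∀ {w : Fin D → ℤ},
      (∀ d, |(w d : ℝ) - ∑ i, ∑ x, q i x * V i x d| ≤ ζ * n * R d) →
      Real.exp (-β * n) ≤ smeas (prodMeas q) A * smeas (prodMeas q) B →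
      (1 - ε) ^ n < smeas (prodMeas q) (levelSet V ∅ (A ∩ B) w) := by
  obtain ⟨h, hh⟩ := exists_nat_ge (64 / κ)
  set Λ : ℕ := (2 + h) * M + 2 with hΛ
  set Q : ℝ := k * (3 + 4 * Λ + 2 * M) with hQ
  obtain ⟨η, hη, hηW⟩ := exists_pos_mul_lt (show 0 < ε * κ * γ by positivity)
    (16 * Λ + 16 * Q + 32 * (M * Q) + 8)
  have hεκγ : ε * κ * γ ≤ ε * κ := mul_le_of_le_one_right (by positivity) hγ1.le
  have hκγ : ε * κ * γ ≤ κ * γ := by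
    rw [mul_assoc]; exact mul_le_of_le_one_left (by positivity) hε1.le
  have hκγ' : κ * γ ≤ γ := mul_le_of_le_one_left hγ.le hκ1.le
  have hΛη : 0 ≤ (Λ : ℝ) * η := by positivity
  have hQη : 0 ≤ Q * η := by positivity
  have hMQη : 0 ≤ (M : ℝ) * Q * η := by positivity
  set τ : ℝ := η / (4 * (k + 1)) with hτdef
  have hτ : 0 < τ := by positivity
  have hτk : 4 * (k + 1) * τ = η := by rw [hτdef]; field_simp
  have hkτ : 0 ≤ (k : ℝ) * τ := by positivity
  have hτη : τ ≤ η := by linarith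
  set ρ : ℝ := τ ^ 2 / 32 with hρdef
  have hρ : 0 < ρ := by positivity
  have hρε : ρ ≤ ε / 8 := by nlinarith
  obtain ⟨L, hL⟩ := exists_exp_mul_prod_pow_le_smeas (κ := κ / 2) (ρ := ρ / 2) (by positivity)
    (by linarith) (by positivity) 2
  obtain ⟨c, hc, hcW⟩ := exists_pos_mul_lt hρ (64 * (L * M) + 4)
  have hLMc : 0 ≤ (L : ℝ) * M * c := by positivity
  obtain ⟨β, hβ, hβW⟩ := exists_pos_mul_lt (show 0 < min (η * κ * c) ρ by positivity)
    (4 * L + 8)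
  have hLβ : 0 ≤ (L : ℝ) * β := by positivity
  have hβ1 := hβW.trans_le (min_le_left _ _)
  have hβ2 := hβW.trans_le (min_le_right _ _)
  obtain ⟨n₁, hn₁⟩ := exists_two_mul_pow_le_exp M (show 0 < ε / 8 by positivity)
  obtain ⟨n₂, hn₂⟩ := exists_nat_ge (1 / τ)
  obtain ⟨n₃, hn₃⟩ := exists_nat_ge (4 * D / ρ)
  refine ⟨τ, hτ, β, hβ, n₁ + n₂ + n₃, ?_⟩
  intro ζ hζ n hn K _ q hq hq1 rA rB hr V R hR hV U hU hgen P hdisj hPγ hP A B hA hB w hw hAB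
  have hnτ : 1 ≤ τ * n := by
    have : (1 / τ : ℝ) ≤ n := hn₂.trans (by exact_mod_cast (by omega : n₂ ≤ n))
    rwa [div_le_iff₀ hτ, mul_comm] at this
  have hn0 : (0 : ℝ) < n := by
    by_contra! hneg
    nlinarith
  have hnη : 1 ≤ η * n := hnτ.trans (mul_le_mul_of_nonneg_right hτη hn0.le)
  have hnD : 4 * (D : ℝ) ≤ ρ * n := by
    have : 4 * D / ρ ≤ n := hn₃.trans (by exact_mod_cast (by omega : n₃ ≤ n))
    rwa [div_le_iff₀ hρ, mul_comm (n : ℝ)] at this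
  have hζn : ζ * n ≤ τ * n := mul_le_mul_of_nonneg_right hζ.2.le hn0.le
  have hζn0 : 0 ≤ ζ * n := mul_nonneg hζ.1.le hn0.le
  set s : ℕ := ⌈η * n⌉₊ with hs
  have hs1 : η * n ≤ s := Nat.le_ceil _
  have hs2 : (s : ℝ) ≤ 2 * (η * n) := by
    have := Nat.ceil_lt_add_one (show 0 ≤ η * n by positivity)
    linarith
  have hΛs : (Λ : ℝ) * s ≤ 2 * (Λ * η) * n :=
    (mul_le_mul_of_nonneg_left hs2 (Nat.cast_nonneg Λ)).trans (le_of_eq (by ring))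
  have hPN : ∀ m, γ / 2 * n ≤ ((P m).card : ℝ) - (Λ * s : ℕ) := fun m => by
    have h1 := hPγ m
    have h2 : 2 * (Λ * η) * n ≤ γ / 2 * n :=
      mul_le_mul_of_nonneg_right (by linarith) hn0.le
    push_cast
    linarith
  have hMs : (M : ℝ) * s ≤ 2 * (M * η) * n :=
    (mul_le_mul_of_nonneg_left hs2 (Nat.cast_nonneg M)).trans (le_of_eq (by ring))
  have hc1 : c ≤ 1 / 4 := by linarith
  have key := smeas_levelSet_lower_bound hκ hκ1.le hc hc1 hq hq1 hr hR hV hU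
    (k := k) (g := k * ζ * n) hgen hdisj hP hA hB hw hζn0 (s := s) (N := Λ * s) (L := L)
    (b := β * n) (r := ρ / 2 * n) (τ := τ) (Y := Q * η * n) (e := ρ * n)
    (by rwa [← neg_mul]) ?_ ?_ ?_ ?_ ?_ hτ (by linarith) ?_ ?_ ?_
  · set F := smeas (prodMeas q) (levelSet V ∅ (A ∩ B) w) with hF
    have hF0 : 0 ≤ F := smeas_nonneg (fun i x => hκ.le.trans (hq i x)) _
    have h1 : Real.exp (-(ε / 8 * n)) ≤ κ ^ (Λ * s) := by
      refine le_trans ?_ (pow_le_pow_left₀ (Real.exp_pos _).le (exp_neg_inv_le hκ) _)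
      rw [← Real.exp_nat_mul, Real.exp_le_exp, mul_neg, neg_le_neg_iff, mul_one_div,
        div_le_iff₀ hκ]
      have : 2 * (Λ * η) * n ≤ ε * κ / 8 * n := mul_le_mul_of_nonneg_right (by linarith) hn0.le
      push_cast
      linarith
    have h2 : 2 * (2 * (s : ℝ) + 1) ^ M ≤ Real.exp (ε / 8 * n) := by
      refine le_trans ?_ (hn₁ n (by omega))
      have := mul_le_mul_of_nonneg_right (by linarith : η ≤ 1 / 2) hn0.le
      refine mul_le_mul_of_nonneg_left (pow_le_pow_left₀ (by positivity) ?_ M) (by norm_num)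
      linarith
    have h3 : Real.exp (4 * (M * (Q * η * n)) / κ) ≤ Real.exp (ε / 8 * n) := by
      rw [Real.exp_le_exp, div_le_iff₀ hκ]
      have : 4 * (M * Q * η) * n ≤ ε * κ / 8 * n :=
        mul_le_mul_of_nonneg_right (by linarith) hn0.le
      linarith
    have h4 : Real.exp (-(ε / 8 * n)) ≤ Real.exp (-(ρ * n)) := by
      rw [Real.exp_le_exp, neg_le_neg_iff]
      exact mul_le_mul_of_nonneg_right hρε hn0.le
    have h5 := exp_neg_le_of_mul_le_mul (by positivity) hF0 h1 h4 h2 h3 key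
    have h6 : (1 - ε) ^ n ≤ Real.exp (-(ε * n)) := by
      have := pow_le_pow_left₀ (by linarith) (Real.one_sub_le_exp_neg ε) n
      rwa [← Real.exp_nat_mul, mul_comm, neg_mul] at this
    refine h6.trans_lt (lt_of_lt_of_le (Real.exp_lt_exp.2 ?_) h5)
    have : 0 < ε * n := by positivity
    linarith
  · have hκs : 0 < (κ * c) * s := by
      have : (0 : ℝ) < s := by linarith
      positivity
    have h1 : β * n * 8 ≤ (κ * c) * s := by
      calc β * n * 8 = (β * 8) * n := by ring
        _ ≤ (η * κ * c) * n := mul_le_mul_of_nonneg_right (by linarith) hn0.le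
        _ = (κ * c) * (η * n) := by ring
        _ ≤ _ := mul_le_mul_of_nonneg_left hs1 (by positivity)
    have h2 : 64 ≤ h * κ := (div_le_iff₀ hκ).1 hh
    have h3 : 64 * (c * M * s) ≤ h * κ * (c * M * s) :=
      mul_le_mul_of_nonneg_right h2 (by positivity)
    rw [hΛ]
    push_cast
    linarith
  · intro q' hq' hq'1 A' B' hA' hB'
    have h1 := hL (T := Bool) (by simp) (r := fun t => cond t rA rB)
      (fun y => by
        obtain ⟨z, hz1, hz2⟩ := hr (y true) (y false)
        exact ⟨z, fun t => by cases t <;> assumption⟩) hq' hq'1 (fun t => cond t A' B')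
      (fun t => by cases t <;> assumption)
    rw [Fintype.prod_bool] at h1
    rw [mul_pow, ← neg_mul]
    refine h1.trans (le_of_eq ?_)
    congr 1
    ext a
    simp [Bool.forall_bool, and_comm]
  · have h1 : (k : ℝ) * (ζ * n + 2 * (Λ * s : ℕ) + M * s + 1 + ζ * n)
        ≤ k * ((3 + 4 * Λ + 2 * M) * (η * n)) := by
      refine mul_le_mul_of_nonneg_left ?_ (Nat.cast_nonneg k)
      have := mul_le_mul_of_nonneg_right hτη hn0.le
      push_cast
      linarith
    rw [hQ]
    linarith
  · intro m
    have h1 := mul_le_mul_of_nonneg_left (hPN m) (show 0 ≤ κ / 8 by positivity)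
    have h2 : Q * η * n ≤ κ * γ / 16 * n := mul_le_mul_of_nonneg_right (by linarith) hn0.le
    linarith
  · intro m
    have h1 := hPN m
    have h2 : 0 ≤ γ / 2 * n := by positivity
    exact_mod_cast (by linarith : ((Λ * s : ℕ) : ℝ) ≤ (P m).card)
  · have h1 := mul_le_mul_of_nonneg_left hζn (Nat.cast_nonneg (α := ℝ) k)
    have h2 := mul_le_mul_of_nonneg_left hnτ (Nat.cast_nonneg (α := ℝ) k)
    have h3 : η * n = 4 * (k * (τ * n)) + 4 * (τ * n) := by rw [← hτk]; ring
    have h4 : 0 ≤ (k : ℝ) * (τ * n) := by positivity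
    linarith
  · have h1 : (L : ℝ) * (4 * c * (M * (2 * s))) ≤ ρ / 4 * n := by
      calc (L : ℝ) * (4 * c * (M * (2 * s))) = (8 * (L * M * c)) * s := by ring
        _ ≤ (8 * (L * M * c)) * (2 * n) := by
            refine mul_le_mul_of_nonneg_left ?_ (by positivity)
            have := mul_le_mul_of_nonneg_right (by linarith : η ≤ 1) hn0.le
            linarith
        _ = (16 * (L * M * c)) * n := by ring
        _ ≤ _ := mul_le_mul_of_nonneg_right (by linarith) hn0.le
    have h2 : (L : ℝ) * β * n ≤ ρ / 4 * n := mul_le_mul_of_nonneg_right (by linarith) hn0.le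
    linarith
  · have h1 : Real.exp (-(τ ^ 2 * n / 16)) = Real.exp (-(ρ * n)) * Real.exp (-(ρ * n)) := by
      rw [← Real.exp_add, hρdef]
      congr 1
      ring
    have h2 : 4 * D * Real.exp (-(ρ * n)) ≤ 1 := by
      rw [Real.exp_neg, mul_inv_le_iff₀ (Real.exp_pos _), one_mul]
      linarith [Real.add_one_le_exp (ρ * n)]
    have h3 := mul_le_mul_of_nonneg_right h2 (Real.exp_pos (-(ρ * n))).le
    rw [h1]
    linarith

end Parameters

section Alphabet

theorem abs_le_of_rnorm_le {D : ℕ} {R : Fin D → ℝ} (hR : ∀ d, 0 < R d) {v : Fin D → ℝ} {r : ℝ}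
    (h : rnorm R v ≤ r) (d : Fin D) : |v d| ≤ r * R d := by
  rw [← div_le_iff₀ (hR d)]
  exact (le_ciSup (f := fun d => |v d| / R d) (Set.finite_range _).bddAbove d).trans h

theorem rnorm_le {D : ℕ} {R : Fin D → ℝ} (hR : ∀ d, 0 < R d) {v : Fin D → ℝ} {r : ℝ}
    (hr : 0 ≤ r) (h : ∀ d, |v d| ≤ r * R d) : rnorm R v ≤ r :=
  Real.iSup_le (fun d => (div_le_iff₀ (hR d)).2 (h d)) hr

theorem GeneratingSet.one_le {D M k : ℕ} {B : ℝ} {U : Fin M → Fin D → ℤ} {R : Fin D → ℝ}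
    (h : GeneratingSet U k B R) (hU : ∀ m d, |(U m d : ℝ)| ≤ R d) (d : Fin D) : 1 ≤ R d := by
  by_contra! hd
  have hU0 : ∀ m, U m d = 0 := fun m => Int.abs_lt_one_iff.1 (by
    exact_mod_cast (hU m d).trans_lt hd)
  obtain ⟨c, -, hc⟩ := h (Pi.single d 1)
  have := hc d
  simp [hU0] at this

variable {S : Type*} {J : S → Type*}

/-- Strings over the product alphabet that agree at all coordinates in `T`. -/
def agreeOn (T : Finset S) : Setoid (∀ s, J s) where
  r x y := ∀ s ∈ T, x s = y s
  iseqv := ⟨fun _ _ _ => rfl, fun h s hs => (h s hs).symm,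
    fun h h' s hs => (h s hs).trans (h' s hs)⟩

theorem determined_agreeOn {n : ℕ} (T : Finset S) (A : ∀ s, Set (Fin n → J s)) :
    Determined (agreeOn T) univ {a : Fin n → ∀ s, J s | ∀ s ∈ T, (fun i => a i s) ∈ A s} := by
  intro a b hab ha s hs
  rw [← show (fun i => a i s) = fun i => b i s from funext fun i => hab i (mem_univ i) s hs]
  exact ha s hs

theorem IsTransfer.hasTransfer [Fintype S] [DecidableEq S] {n D : ℕ} {S' : Finset S}
    {V : Fin n → (∀ s, J s) → Fin D → ℤ} {i : Fin n} {u : Fin D → ℤ}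
    (h : IsTransfer S' V i u) : HasTransfer (agreeOn S') (agreeOn S'ᶜ) (V i) u := by
  obtain ⟨a, a', b, b', hu, hv⟩ := h
  refine ⟨combine S' a b, combine S' a' b, combine S' a b', combine S' a' b', ?_, ?_, ?_, ?_,
    funext hu, funext fun d => (hv d).symm⟩ <;> intro s hs
  · simp [combine, hs]
  · simp [combine, hs]
  · simp [combine, mem_compl.1 hs]
  · simp [combine, mem_compl.1 hs]

/-- Dense cylinder sets in the various components intersect in a set of large measure. -/
theorem exists_exp_le_smeas_cylinder {κ β : ℝ} (hκ : 0 < κ) (hκ1 : κ ≤ 1) (hβ : 0 < β) (C : ℕ) :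
    ∃ δ₀ > (0 : ℝ), ∀ δ ∈ Set.Ioc 0 δ₀, ∀ {n : ℕ} {S : Type} [Fintype S] {J : S → Type}
      [∀ s, Fintype (J s)] [Fintype (∀ s, J s)], Fintype.card S ≤ C →
      ∀ {q : Fin n → (∀ s, J s) → ℝ}, (∀ i, ∑ x, q i x = 1) → (∀ i x, κ ≤ q i x) →
      ∀ {p : (s : S) → Fin n → J s → ℝ}, (∀ s i j, p s i j =
        ∑ a, ({a' : ∀ s', J s' | a' s = j} : Set _).indicator (q i) a) →
      ∀ {A : ∀ s, Set (Fin n → J s)}, (1 - δ) ^ n < ∏ s, smeas (prodMeas (p s)) (A s) →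
      ∀ T : Finset S,
        Real.exp (-(β * n)) ≤ smeas (prodMeas q) {a | ∀ s ∈ T, (fun i => a i s) ∈ A s} := by
  obtain ⟨N, hN⟩ := exists_exp_mul_prod_pow_le_smeas hκ hκ1 (half_pos hβ) C
  refine ⟨min (1 / 2) (β / (4 * (N + 1))), by positivity, ?_⟩
  intro δ hδ n S _ J _ _ hS q hq1 hq p hp A hA T
  classical
  have hq0 : ∀ i x, 0 ≤ q i x := fun i x => hκ.le.trans (hq i x)
  have hδ1 : δ ≤ 1 / 2 := hδ.2.trans (min_le_left _ _)
  have hδ2 : δ * (4 * (N + 1)) ≤ β := by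
    rw [← le_div_iff₀ (by positivity)]
    exact hδ.2.trans (min_le_right _ _)
  set A' : S → Set (Fin n → ∀ s, J s) :=
    fun s => {a | s ∈ T → (fun i => a i s) ∈ A s} with hA'
  have h1 := hN hS (r := fun s => agreeOn {s})
    (fun y => ⟨fun s => y s s, fun s s' hs' => by rw [mem_singleton.1 hs']⟩) hq hq1 A'
    (fun s a b hab ha hs => by
      rw [← show (fun i => a i s) = fun i => b i s from
        funext fun i => hab i (mem_univ i) s (mem_singleton_self s)]
      exact ha hs)
  have h2 : ∏ s, smeas (prodMeas (p s)) (A s) ≤ ∏ s, smeas (prodMeas q) (A' s) := by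
    have h3 : ∀ s, smeas (prodMeas (p s)) (A s)
        = smeas (prodMeas q) {a | (fun i => a i s) ∈ A s} := fun s =>
      smeas_pushforward (fun x => x s) q (p s) (hp s) (A s)
    refine prod_le_prod (fun s _ => ?_) fun s _ => ?_
    · rw [h3]
      exact smeas_nonneg hq0 _
    · rw [h3]
      exact smeas_mono hq0 fun a ha _ => ha
  have h4 : Real.exp (-(2 * δ)) ≤ 1 - δ := by
    rw [Real.exp_neg, inv_le_comm₀ (Real.exp_pos _) (by linarith)]
    refine le_trans ?_ (Real.add_one_le_exp (2 * δ))
    rw [inv_le_iff_one_le_mul₀ (by linarith)]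
    nlinarith [hδ.1]
  have h5 : Real.exp (-(β / 2 * n)) ≤ (∏ s, smeas (prodMeas q) (A' s)) ^ N := by
    refine le_trans ?_ (pow_le_pow_left₀ (by positivity)
      ((pow_le_pow_left₀ (Real.exp_pos _).le h4 n).trans (hA.le.trans h2)) N)
    rw [← Real.exp_nat_mul, ← Real.exp_nat_mul, Real.exp_le_exp]
    have h6 : 2 * δ * N ≤ β / 2 := by nlinarith [hδ.1]
    have h7 := mul_le_mul_of_nonneg_right h6 (Nat.cast_nonneg (α := ℝ) n)
    linarith
  rw [prod_pow] at h1
  calc Real.exp (-(β * n)) = Real.exp (-(β / 2) * n) * Real.exp (-(β / 2 * n)) := by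
        rw [← Real.exp_add]
        congr 1
        ring
    _ ≤ _ := mul_le_mul_of_nonneg_left h5 (Real.exp_pos _).le
    _ ≤ _ := h1

end Alphabet

/-- **General forbidden intersection theorem.** -/
theorem general_forbidden_intersections (D M k C : ℕ) :
    ∃ θ₁ > (0:ℝ), ∀ ε ∈ Set.Ioo (0:ℝ) θ₁, ∀ κ ∈ Set.Ioo (0:ℝ) θ₁, ∀ γ ∈ Set.Ioo (0:ℝ) θ₁,
    ∃ θ₂ > (0:ℝ), ∀ ζ ∈ Set.Ioo (0:ℝ) θ₂,
    ∃ δ₀ > (0:ℝ), ∃ n₀ : ℕ, ∀ n, n₀ ≤ n → ∀ δ ∈ Set.Ioc (0:ℝ) δ₀,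
    ∀ (S : Type) [Fintype S] [DecidableEq S], Fintype.card S ≤ C →
    ∀ (J : S → Type) [∀ s, Fintype (J s)], (∀ s, Fintype.card (J s) ≤ C) →
    ∀ R : Fin D → ℝ, (∀ d, 0 < R d) → (∀ d, R d < (n : ℝ) ^ C) →
    ∀ q : Fin n → (∀ s, J s) → ℝ,
      (∀ i, ∑ a : (∀ s, J s), q i a = 1) →
      (∀ i a, q i a ∈ Set.Icc κ (1 - κ)) →
    ∀ p : (s : S) → Fin n → J s → ℝ,
      (∀ s i j, p s i j =
        ∑ a : (∀ s, J s), ({a' : ∀ s', J s' | a' s = j} : Set _).indicator (q i) a) →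
    ∀ V : Fin n → (∀ s, J s) → Fin D → ℤ,
      (∀ i a, rnorm R (fun d => (V i a d : ℝ)) ≤ 1) →
    ∀ U : Fin M → Fin D → ℤ,
      (∀ m, rnorm R (fun d => (U m d : ℝ)) ≤ 1) →
      GeneratingSet U k ((k : ℝ) * ζ * n) R →
      HasRobustTransfers γ U V →
    ∀ w : Fin D → ℤ,
      rnorm R (fun d => (w d : ℝ) - arrExp V (prodMeas q) d) < ζ * n →
    ∀ A : (s : S) → Set (Fin n → J s),
      (1 - δ) ^ n < ∏ s, smeas (prodMeas (p s)) (A s) →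
      (1 - ε) ^ n <
        smeas (prodMeas q)
          {a : Fin n → (∀ s, J s) |
            (∀ s, (fun i => a i s) ∈ A s) ∧ ∀ d, arrEval V a d = w d} := by
  refine ⟨1, one_pos, fun ε hε κ hκ γ hγ => ?_⟩
  obtain ⟨θ, hθ, β, hβ, n₀, hmain⟩ := exists_forall_lt_smeas_levelSet D M k hε.1 hε.2 hκ.1 hκ.2
    hγ.1 hγ.2
  obtain ⟨δ₀, hδ₀, hcyl⟩ := exists_exp_le_smeas_cylinder hκ.1 hκ.2.le (half_pos hβ) C
  refine ⟨θ, hθ, fun ζ hζ => ⟨δ₀, hδ₀, n₀, ?_⟩⟩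
  intro n hn δ hδ S _ _ hS J _ _ R hR _ q hq1 hq p hp V hV U hU hgen ⟨S', P, hdisj, hPγ, hP⟩
    w hw A hA
  have hV' : ∀ i x d, |(V i x d : ℝ)| ≤ R d := fun i x d => by
    simpa using abs_le_of_rnorm_le hR (hV i x) d
  have hU' : ∀ m d, |(U m d : ℝ)| ≤ R d := fun m d => by
    simpa using abs_le_of_rnorm_le hR (hU m) d
  have hq' : ∀ i x, κ ≤ q i x := fun i x => (hq i x).1
  refine lt_of_lt_of_le (hmain ζ hζ n hn hq' hq1 (rA := agreeOn S') (rB := agreeOn S'ᶜ) ?_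
    (fun d => hgen.one_le hU' d) hV' hU' ?_ hdisj hPγ (fun m i hi => (hP m i hi).hasTransfer)
    (determined_agreeOn S' A) (determined_agreeOn S'ᶜ A) (w := w) (fun d => ?_) ?_)
    (smeas_mono (fun i x => hκ.1.le.trans (hq' i x)) ?_)
  · intro x y
    refine ⟨combine S' x y, fun s hs => ?_, fun s hs => ?_⟩
    · simp [combine, hs]
    · simp [combine, mem_compl.1 hs]
  · intro r u hr hu
    obtain ⟨t, ht, htu⟩ := hgen u
    refine ⟨t, fun m => (ht m).trans (add_le_add (mul_le_mul_of_nonneg_left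
      (rnorm_le hR hr hu) (Nat.cast_nonneg k)) le_rfl), funext fun d => ?_⟩
    simpa using htu d
  · have := abs_le_of_rnorm_le hR hw.le d
    rwa [arrExp_prodMeas hq1] at this
  · refine le_trans (le_of_eq ?_) (mul_le_mul (hcyl δ hδ hS hq1 hq' hp hA S')
      (hcyl δ hδ hS hq1 hq' hp hA S'ᶜ) (Real.exp_pos _).le
      (smeas_nonneg (fun i x => hκ.1.le.trans (hq' i x)) _))
    rw [← Real.exp_add]
    congr 1
    ring
  · rintro a ⟨⟨ha, ha'⟩, hsum⟩
    refine ⟨fun s => ?_, fun d => ?_⟩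
    · by_cases hs : s ∈ S'
      · exact ha s hs
      · exact ha' s (mem_compl.2 hs)
    · have := congrFun hsum d
      simpa [arrEval] using this
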